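/- arXiv:cond-mat/0110180 — 3 statements merged into one kernel-verified Lean document; each statement's English description precedes it below -/
import Mathlib

section
/- Let λ_c = 2/(3√3) and 𝒜₀ = 3/2. There exist constants γ₁ > 0, ε₀ > 0 and c₊ > c₋ > 0 with the following property. For every ε ∈ (0,ε₀] and every amplitude A with λ_c + γ₁ ε ≤ A ≤ 2λ_c, the equation ε ẋ = x − x³ − A cos(2πt) admits a periodic solution x̂ of period 1 which changes sign twice per period and attracts all solutions (for every solution x, |x_t − x̂_t| → 0 as t → ∞); writing λ(t) = −A cos(2πt), its hysteresis area 𝒜 = −∫₀¹ x̂_t λ'(t) dt satisfies c₋ ε^{2/3} (A − λ_c)^{1/3} ≤ 𝒜 − 𝒜₀ ≤ c₊ ε^{2/3} (A − λ_c)^{1/3}. -/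
open MeasureTheory Real Set


namespace Hyst

/-- Comparison of increments from comparison of derivatives. -/
lemma incr_le {f g f' g' : ℝ → ℝ} {a b : ℝ} (hab : a ≤ b)
    (hf : ∀ t ∈ Icc a b, HasDerivAt f (f' t) t) (hg : ∀ t ∈ Icc a b, HasDerivAt g (g' t) t)
    (h : ∀ t ∈ Ioo a b, f' t ≤ g' t) : f b - f a ≤ g b - g a := by
  have hd : ∀ t ∈ Icc a b, HasDerivAt (fun t => g t - f t) (g' t - f' t) t :=
    fun t ht => (hg t ht).sub (hf t ht)
  have hm : MonotoneOn (fun t => g t - f t) (Icc a b) := by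
    apply monotoneOn_of_deriv_nonneg (convex_Icc a b)
    · exact fun t ht => (hd t ht).continuousAt.continuousWithinAt
    · intro t ht
      rw [interior_Icc] at ht
      exact (hd t (Ioo_subset_Icc_self ht)).differentiableAt.differentiableWithinAt
    · intro t ht
      rw [interior_Icc] at ht
      rw [(hd t (Ioo_subset_Icc_self ht)).deriv]
      linarith [h t ht]
  have := hm (left_mem_Icc.2 hab) (right_mem_Icc.2 hab) hab
  simp only at this
  linarith

/-- Preservation of the sign `y ≤ 0`. -/
lemma sgn_le {y y' : ℝ → ℝ} {a b K : ℝ} (hy : ∀ t ∈ Icc a b, HasDerivAt y (y' t) t)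
    (ha : y a ≤ 0) (h : ∀ t ∈ Icc a b, 0 < y t → y' t ≤ K * y t) :
    ∀ t ∈ Icc a b, y t ≤ 0 := by
  intro t ht
  have key : ∀ δ > 0, y t ≤ δ * exp ((K + 1) * (t - a)) := by
    intro δ hδ
    have hB : ∀ s, HasDerivAt (fun s => δ * exp ((K + 1) * (s - a)))
        (δ * (exp ((K + 1) * (s - a)) * ((K + 1) * 1))) s := by
      intro s
      exact ((((hasDerivAt_id s).sub_const a).const_mul (K + 1)).exp).const_mul δ
    refine image_le_of_deriv_right_lt_deriv_boundary
      (f := y) (f' := y') (a := a) (b := b) ?_ ?_ ?_ hB ?_ ht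
    · exact fun s hs => (hy s hs).continuousAt.continuousWithinAt
    · exact fun s hs => (hy s (Ico_subset_Icc_self hs)).hasDerivWithinAt
    · simp; linarith
    · intro s hs hsy
      have hpos : 0 < δ * exp ((K + 1) * (s - a)) := by positivity
      have := h s (Ico_subset_Icc_self hs) (by rw [hsy]; exact hpos)
      rw [hsy] at this
      nlinarith
  by_contra hc
  push Not at hc
  have hE : 0 < exp ((K + 1) * (t - a)) := exp_pos _
  have := key (y t / (2 * exp ((K + 1) * (t - a)))) (by positivity)
  have h2 : y t / (2 * exp ((K + 1) * (t - a))) * exp ((K + 1) * (t - a)) = y t / 2 := by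
    field_simp
  linarith

/-- Gronwall. -/
lemma gron {y y' : ℝ → ℝ} {a b c : ℝ} (hab : a ≤ b) (hy : ∀ t ∈ Icc a b, HasDerivAt y (y' t) t)
    (h : ∀ t ∈ Icc a b, y' t ≤ c * y t) : y b ≤ y a * exp (c * (b - a)) := by
  have hE : ∀ s, HasDerivAt (fun s => y a * exp (c * (s - a)))
      (y a * (exp (c * (s - a)) * (c * 1))) s := by
    intro s
    exact ((((hasDerivAt_id s).sub_const a).const_mul c).exp).const_mul (y a)
  have := sgn_le (y := fun s => y s - y a * exp (c * (s - a))) (K := c)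
    (fun t ht => (hy t ht).sub (hE t)) (by simp)
    (by
      intro t ht _
      have := h t ht
      nlinarith) b (right_mem_Icc.2 hab)
  linarith

/-- Comparison principle for `ε ẋ = x - x³ + lam`. -/
lemma comp_le {u w u' w' lam : ℝ → ℝ} {a b ε : ℝ} (hε : 0 < ε)
    (hu : ∀ t ∈ Icc a b, HasDerivAt u (u' t) t) (hw : ∀ t ∈ Icc a b, HasDerivAt w (w' t) t)
    (hu' : ∀ t ∈ Icc a b, u' t ≤ (u t - u t ^ 3 + lam t) / ε)
    (hw' : ∀ t ∈ Icc a b, (w t - w t ^ 3 + lam t) / ε ≤ w' t)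
    (h0 : u a ≤ w a) : ∀ t ∈ Icc a b, u t ≤ w t := by
  intro t ht
  have := sgn_le (y := fun s => u s - w s) (K := 1 / ε)
    (fun t ht => (hu t ht).sub (hw t ht)) (by simpa using h0)
    (by
      intro s hs hpos
      have h1 := hu' s hs
      have h2 := hw' s hs
      have h3 : (u s - u s ^ 3 + lam s) / ε - (w s - w s ^ 3 + lam s) / ε ≤ 1 / ε * (u s - w s) := by
        rw [← sub_div, one_div, inv_mul_eq_div]
        apply div_le_div_of_nonneg_right _ hε.le
        have hQ : 0 ≤ u s ^ 2 + u s * w s + w s ^ 2 := by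
          nlinarith [sq_nonneg (u s + w s), sq_nonneg (u s), sq_nonneg (w s)]
        nlinarith [mul_nonneg hpos.le hQ]
      linarith) t ht
  linarith

/-- Global existence for bounded Lipschitz fields. -/
lemma exists_global {F : ℝ → ℝ → ℝ} {K L : NNReal} (hL : ∀ t, LipschitzWith K (F t))
    (hc : ∀ x, Continuous fun t => F t x) (hb : ∀ t x, ‖F t x‖ ≤ L) (t₀ x₀ : ℝ) :
    ∃ x : ℝ → ℝ, x t₀ = x₀ ∧ ∀ t, HasDerivAt x (F t (x t)) t := by
  have hloc : ∀ n : ℕ, ∃ x : ℝ → ℝ, x t₀ = x₀ ∧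
      ∀ t ∈ Ioo (t₀ - (n + 1)) (t₀ + (n + 1)), HasDerivAt x (F t (x t)) t := by
    intro n
    have hpl : IsPicardLindelof F (tmin := t₀ - (n + 1)) (tmax := t₀ + (n + 1))
        ⟨t₀, by constructor <;> linarith [Nat.cast_nonneg (α := ℝ) n]⟩ x₀ (L * (n + 1)) 0 L K := by
      refine ⟨fun t _ => (hL t).lipschitzOnWith, fun x _ => (hc x).continuousOn,
        fun t _ x _ => hb t x, ?_⟩
      simp
    obtain ⟨α, h0, hα⟩ := hpl.exists_eq_forall_mem_Icc_hasDerivWithinAt₀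
    exact ⟨α, h0, fun t ht => (hα t (Ioo_subset_Icc_self ht)).hasDerivAt (Icc_mem_nhds ht.1 ht.2)⟩
  choose X hX0 hX using hloc
  have huniq : ∀ n m : ℕ, n ≤ m → ∀ t ∈ Ioo (t₀ - (n + 1)) (t₀ + (n + 1)), X n t = X m t := by
    intro n m hnm
    have hnm' : (n : ℝ) ≤ m := by exact_mod_cast hnm
    refine ODE_solution_unique_of_mem_Ioo (v := F) (s := fun _ => univ) (K := K) (t₀ := t₀)
      (fun t _ => (hL t).lipschitzOnWith) ?_ ?_ ?_ ?_
    · constructor <;> linarith [Nat.cast_nonneg (α := ℝ) n]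
    · exact fun t ht => ⟨hX n t ht, trivial⟩
    · exact fun t ht => ⟨hX m t ⟨by linarith [ht.1], by linarith [ht.2]⟩, trivial⟩
    · rw [hX0, hX0]
  refine ⟨fun t => X ⌈|t - t₀|⌉₊ t, ?_, ?_⟩
  · simp [hX0]
  · intro t
    set N : ℕ := ⌈|t - t₀|⌉₊ + 1 with hN
    have hmem : ∀ s, s ∈ Ioo (t₀ - (⌈|s - t₀|⌉₊ + 1 : ℝ)) (t₀ + (⌈|s - t₀|⌉₊ + 1 : ℝ)) := by
      intro s
      have h1 := Nat.le_ceil |s - t₀|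
      have h2 := abs_le.1 h1
      constructor <;> linarith [h2.1, h2.2]
    have hev : (fun s => X ⌈|s - t₀|⌉₊ s) =ᶠ[nhds t] X N := by
      have hball : Ioo (t - 1) (t + 1) ∈ nhds t := Ioo_mem_nhds (by linarith) (by linarith)
      filter_upwards [hball] with s hs
      apply huniq _ _ _ s (hmem s)
      rw [hN]
      apply Nat.ceil_le.2
      push_cast
      have h1 := Nat.le_ceil |t - t₀|
      have h3 : |s - t| ≤ 1 := abs_le.2 ⟨by linarith [hs.1], by linarith [hs.2]⟩
      have h4 := abs_sub_le s t t₀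
      linarith
    have hval := hev.eq_of_nhds
    show HasDerivAt _ (F t (X ⌈|t - t₀|⌉₊ t)) t
    rw [hval]
    refine HasDerivAt.congr_of_eventuallyEq ?_ hev
    apply hX
    have := hmem t
    rw [hN]
    push_cast
    constructor <;> linarith [this.1, this.2]

end Hyst


namespace Hyst

/-- The facts on the forcing `lam(t) = -A cos (2πt)` used below; `k = 1/√3`, `λ_c = 2k/3`,
`lam T0 = -λ_c`, `ρ = |lam'(T0)|`. -/
structure Frc (k T0 ρ : ℝ) (lam lam' : ℝ → ℝ) : Prop where
  k3 : 3 * k ^ 2 = 1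
  klo : 0.577 < k
  khi : k < 0.578
  T0lo : -1 / 4 < T0
  rpos : 0 < ρ
  rle : ρ ≤ 5
  der : ∀ t, HasDerivAt lam (lam' t) t
  lamT0 : lam T0 = -(2 * k / 3)
  lamtc : lam (T0 + 1 / 2) = 2 * k / 3
  lam_le : ∀ t ∈ Icc T0 (T0 + 1 / 2), lam t ≤ 2 * k / 3
  lam_neg : ∀ t ∈ Icc T0 (1 / 4), lam t ≤ 0
  lam_abs : ∀ t, |lam t| ≤ 1
  der_lo : ∀ t ∈ Icc T0 0, -ρ ≤ lam' t
  der_neg : ∀ t ∈ Icc T0 0, lam' t ≤ 0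
  der_hi : ∀ t ∈ Icc T0 0, lam' t ≤ -ρ + 31 * (t - T0)
  T0rho : T0 ≤ -ρ / 31
  der_pos : ∀ t ∈ Icc 0 (T0 + 1 / 2), 0 ≤ lam' t
  der_sq : ∀ t ∈ Icc 0 (T0 + 1 / 2), lam' t ^ 2 ≤ ρ ^ 2 + 31 * (2 * k / 3 - lam t)

/-- Relations between the small parameters, `q = (ερ)^{1/3}`. -/
structure Par (ε ρ q : ℝ) : Prop where
  ε_pos : 0 < ε
  q_pos : 0 < q
  q3 : q ^ 3 = ε * ρ
  hM : 100 * ε ≤ q ^ 2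
  q_le : q ≤ 1 / 100

/-- `x` solves the equation on `[a,b]`. -/
def IsSol (ε : ℝ) (lam x : ℝ → ℝ) (a b : ℝ) : Prop :=
  ∀ t ∈ Icc a b, HasDerivAt x ((x t - x t ^ 3 + lam t) / ε) t

lemma IsSol.mono {ε : ℝ} {lam x : ℝ → ℝ} {a b a' b' : ℝ} (h : IsSol ε lam x a b)
    (ha : a ≤ a') (hb : b' ≤ b) : IsSol ε lam x a' b' :=
  fun t ht => h t ⟨ha.trans ht.1, ht.2.trans hb⟩


lemma Par.rs {ε ρ q : ℝ} (P : Par ε ρ q)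
    : ρ * (ε / q) = q ^ 2 := by
  have := P.q_pos
  have := P.q3
  field_simp
  linarith

lemma Par.s_pos {ε ρ q : ℝ} (P : Par ε ρ q)
    : 0 < ε / q := div_pos P.ε_pos P.q_pos

lemma Par.s_le {ε ρ q : ℝ} (P : Par ε ρ q)
    : 10000 * (ε / q) ≤ ρ := by
  have hq := P.q_pos
  have h3 := P.q3
  have hM := P.hM
  have hε := P.ε_pos
  rw [← mul_div_assoc, div_le_iff₀ hq]
  have h4 : 10000 * ε ^ 2 ≤ q ^ 4 := by nlinarith [pow_pos hq 2]
  have h5 : ε * (ρ * q) = q ^ 4 := by rw [← mul_assoc, ← h3]; ring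
  by_contra hc
  push Not at hc
  nlinarith

lemma Par.s_small {ε ρ q : ℝ} (P : Par ε ρ q)
    : ε / q ≤ 1 / 10000 := by
  have hq := P.q_pos
  have hM := P.hM
  have := P.q_le
  rw [div_le_iff₀ hq]
  nlinarith



lemma Frc.T0neg {k T0 ρ : ℝ} {lam lam' : ℝ → ℝ} (F : Frc k T0 ρ lam lam')
    : T0 < 0 := by
  have := F.T0rho; have := F.rpos; linarith

lemma Frc.lam_lo1 {k T0 ρ : ℝ} {lam lam' : ℝ → ℝ} (F : Frc k T0 ρ lam lam')
    : ∀ t ∈ Icc T0 0, -(2 * k / 3) - ρ * (t - T0) ≤ lam t := by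
  intro t ht
  have := incr_le (f := fun s => -ρ * s) (g := lam) (f' := fun _ => -ρ * 1) ht.1
    (fun s _ => (hasDerivAt_id s).const_mul (-ρ)) (fun s _ => F.der s)
    (fun s hs => by linarith [F.der_lo s ⟨hs.1.le, hs.2.le.trans ht.2⟩])
  rw [F.lamT0] at this
  linarith

lemma Frc.lam_anti {k T0 ρ : ℝ} {lam lam' : ℝ → ℝ} (F : Frc k T0 ρ lam lam')
    : ∀ s t, T0 ≤ s → s ≤ t → t ≤ 0 → lam t ≤ lam s := by
  intro s t hs hst ht
  have := incr_le (f := lam) (g := fun _ => (0:ℝ)) (g' := fun _ => 0) hst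
    (fun s _ => F.der s) (fun s _ => hasDerivAt_const s _)
    (fun r hr => F.der_neg r ⟨hs.trans hr.1.le, hr.2.le.trans ht⟩)
  linarith

lemma Frc.lam_hi1 {k T0 ρ : ℝ} {lam lam' : ℝ → ℝ} (F : Frc k T0 ρ lam lam')
    : ∀ t ∈ Icc T0 0, lam t ≤ -(2 * k / 3) := by
  intro t ht
  rw [← F.lamT0]
  exact F.lam_anti T0 t le_rfl ht.1 ht.2

lemma Frc.lam_hi2 {k T0 ρ : ℝ} {lam lam' : ℝ → ℝ} (F : Frc k T0 ρ lam lam')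
    {c : ℝ} (hc : 0 ≤ c) (hc2 : c ≤ ρ / 62) :
    ∀ t ∈ Icc (T0 + c) 0, lam t ≤ -(2 * k / 3) - ρ / 2 * c := by
  intro t ht
  have h0 := F.T0rho
  have hr := F.rpos
  have h1 := F.lam_anti (T0 + c) t (by linarith) ht.1 ht.2
  have := incr_le (f := lam) (g := fun s => -(ρ / 2) * s) (g' := fun _ => -(ρ / 2) * 1)
    (a := T0) (b := T0 + c) (by linarith)
    (fun s _ => F.der s) (fun s _ => (hasDerivAt_id s).const_mul (-(ρ / 2)))
    (fun s hs => by linarith [F.der_hi s ⟨hs.1.le, by linarith [hs.2]⟩, hs.2])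
  rw [F.lamT0] at this
  linarith

/-- factorization at the fold. -/
lemma Frc.fac {k T0 ρ : ℝ} {lam lam' : ℝ → ℝ} (F : Frc k T0 ρ lam lam')
    (x : ℝ) : x - x ^ 3 - 2 * k / 3 = -((x - k) ^ 2 * (x + 2 * k)) := by
  have h := F.k3
  have h3 : 3 * k ^ 3 = k := by linear_combination k * h
  linear_combination -x * h + (2/3) * h3

lemma Frc.fac' {k T0 ρ : ℝ} {lam lam' : ℝ → ℝ} (F : Frc k T0 ρ lam lam')
    (x : ℝ) : x - x ^ 3 + 2 * k / 3 = -((x + k) ^ 2 * (x - 2 * k)) := by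
  have h := F.k3
  have h3 : 3 * k ^ 3 = k := by linear_combination k * h
  linear_combination -x * h - (2/3) * h3

lemma Frc.upper2 {k T0 ρ : ℝ} {lam lam' : ℝ → ℝ} (F : Frc k T0 ρ lam lam')
    {ε a b : ℝ} {x : ℝ → ℝ} (hε : 0 < ε) (hx : IsSol ε lam x a b) (h0 : x a ≤ 2) :
    ∀ t ∈ Icc a b, x t ≤ 2 := by
  refine comp_le (w := fun _ => 2) (lam := lam) hε hx (fun t _ => hasDerivAt_const t _)
    (fun t _ => le_rfl) (fun t _ => ?_) h0
  have := abs_le.1 (F.lam_abs t)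
  apply div_nonpos_of_nonpos_of_nonneg _ hε.le
  linarith

lemma Frc.lower2 {k T0 ρ : ℝ} {lam lam' : ℝ → ℝ} (F : Frc k T0 ρ lam lam')
    {ε a b : ℝ} {x : ℝ → ℝ} (hε : 0 < ε) (hx : IsSol ε lam x a b) (h0 : -2 ≤ x a) :
    ∀ t ∈ Icc a b, -2 ≤ x t := by
  refine comp_le (u := fun _ => -2) (lam := lam) hε (fun t _ => hasDerivAt_const t _) hx
    (fun t _ => ?_) (fun t _ => le_rfl) h0
  have := abs_le.1 (F.lam_abs t)
  apply div_nonneg _ hε.le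
  linarith

lemma Frc.upper_neg1 {k T0 ρ : ℝ} {lam lam' : ℝ → ℝ} (F : Frc k T0 ρ lam lam')
    {ε a b : ℝ} {x : ℝ → ℝ} (hε : 0 < ε) (hx : IsSol ε lam x a b)
    (ha : T0 ≤ a) (hb : b ≤ 1 / 4) (h0 : x a ≤ -1) :
    ∀ t ∈ Icc a b, x t ≤ -1 := by
  refine comp_le (w := fun _ => -1) (lam := lam) hε hx (fun t _ => hasDerivAt_const t _)
    (fun t _ => le_rfl) (fun t ht => ?_) h0
  have := F.lam_neg t ⟨ha.trans ht.1, ht.2.trans hb⟩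
  apply div_nonpos_of_nonpos_of_nonneg _ hε.le
  linarith

lemma Frc.upper_negk {k T0 ρ : ℝ} {lam lam' : ℝ → ℝ} (F : Frc k T0 ρ lam lam')
    {ε a b : ℝ} {x : ℝ → ℝ} (hε : 0 < ε) (hx : IsSol ε lam x a b)
    (ha : T0 ≤ a) (hb : b ≤ T0 + 1 / 2) (h0 : x a ≤ -k) :
    ∀ t ∈ Icc a b, x t ≤ -k := by
  refine comp_le (w := fun _ => -k) (lam := lam) hε hx (fun t _ => hasDerivAt_const t _)
    (fun t _ => le_rfl) (fun t ht => ?_) h0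
  have := F.lam_le t ⟨ha.trans ht.1, ht.2.trans hb⟩
  apply div_nonpos_of_nonpos_of_nonneg _ hε.le
  have h := F.fac' (-k)
  simp at h
  linarith

/-- all solutions have jumped at time `T0 + 25 ε/q`. -/
lemma Frc.jump {k T0 ρ : ℝ} {lam lam' : ℝ → ℝ} (F : Frc k T0 ρ lam lam')
    {ε q : ℝ} (P : Par ε ρ q) {x : ℝ → ℝ}
    (hx : IsSol ε lam x T0 (T0 + 25 * (ε / q))) : x (T0 + 25 * (ε / q)) ≤ -1 := by
  have hs := P.s_pos
  have hsl := P.s_le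
  have hrs := P.rs
  have hε := P.ε_pos
  have hq := P.q_pos
  have hT := F.T0rho
  have hr := F.rpos
  set s := ε / q with hsdef
  by_contra hc
  push Not at hc
  have hgt : ∀ t ∈ Icc T0 (T0 + 25 * s), -1 < x t := by
    intro t ht
    by_contra hc2
    push Not at hc2
    have := F.upper_neg1 hε (hx.mono ht.1 le_rfl) ht.1 (by linarith) hc2 _ (right_mem_Icc.2 ht.2)
    linarith
  have hat : ∀ t ∈ Icc (T0 + s) (T0 + 25 * s), HasDerivAt (fun t => arctan ((x t - k) / q))
      (1 / (1 + ((x t - k) / q) ^ 2) * ((x t - x t ^ 3 + lam t) / ε / q)) t := by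
    intro t ht
    exact (((hx t ⟨by linarith [ht.1], ht.2⟩).sub_const k).div_const q).arctan
  have := incr_le (f := fun t => arctan ((x t - k) / q)) (g := fun t => -(q / (7 * ε)) * t)
    (g' := fun _ => -(q / (7 * ε)) * 1)
    (a := T0 + s) (b := T0 + 25 * s) (by linarith) hat
    (fun s _ => (hasDerivAt_id s).const_mul (-(q / (7 * ε)))) (by
      intro t ht
      have h1 := hgt t ⟨by linarith [ht.1], ht.2.le⟩
      have h2 := F.lam_hi2 hs.le (by linarith) t ⟨ht.1.le, by linarith [ht.2]⟩
      have h3 := F.fac (x t)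
      have hk := F.klo
      have h4 : x t - x t ^ 3 + lam t ≤ -(1 / 7) * (q ^ 2 + (x t - k) ^ 2) := by
        have : (1 / 7) * (x t - k) ^ 2 ≤ (x t - k) ^ 2 * (x t + 2 * k) := by
          nlinarith [sq_nonneg (x t - k)]
        nlinarith [sq_nonneg q]
      have hpos : 0 < q ^ 2 + (x t - k) ^ 2 := by positivity
      have h5 : 1 / (1 + ((x t - k) / q) ^ 2) * ((x t - x t ^ 3 + lam t) / ε / q)
          = (x t - x t ^ 3 + lam t) * (q / ε) / (q ^ 2 + (x t - k) ^ 2) := by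
        field_simp
      rw [h5, div_le_iff₀ hpos]
      have h6 : 0 < q / ε := by positivity
      have h7 : q / (7 * ε) = 1 / 7 * (q / ε) := by field_simp
      rw [h7]
      nlinarith)
  have h8 : -(q / (7 * ε)) * (T0 + 25 * s) - -(q / (7 * ε)) * (T0 + s) = - (24 / 7) := by
    rw [hsdef]; field_simp; ring
  have h9 := neg_pi_div_two_lt_arctan ((x (T0 + 25 * s) - k) / q)
  have h10 := arctan_lt_pi_div_two ((x (T0 + s) - k) / q)
  have := pi_lt_d2
  linarith

/-- the solution stays positive for a while. -/
lemma Frc.delay {k T0 ρ : ℝ} {lam lam' : ℝ → ℝ} (F : Frc k T0 ρ lam lam')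
    {ε q : ℝ} (P : Par ε ρ q) {x : ℝ → ℝ}
    (hx : IsSol ε lam x T0 (T0 + ε / q / 3)) (h0 : k ≤ x T0) :
    ∀ t ∈ Icc T0 (T0 + ε / q / 3), 1 / 2 ≤ x t := by
  have hs := P.s_pos
  have hsl := P.s_le
  have hrs := P.rs
  have hε := P.ε_pos
  have hq := P.q_pos
  have hq1 := P.q_le
  have hT := F.T0rho
  have hr := F.rpos
  have hk := F.klo
  have hk2 := F.khi
  have hsq : ε = q * (ε / q) := by field_simp
  set s := ε / q with hsdef
  have key : ∀ t ∈ Icc T0 (T0 + s / 3), k - 3 * q ^ 2 / ε * (t - T0) ≤ x t := by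
    refine comp_le (u := fun t => k - 3 * q ^ 2 / ε * (t - T0))
      (u' := fun _ => -(3 * q ^ 2 / ε * 1)) (lam := lam) hε
      (fun t _ => (((hasDerivAt_id t).sub_const T0).const_mul (3 * q ^ 2 / ε)).const_sub k) hx
      (fun t ht => ?_) (fun t _ => le_rfl) (by simpa using h0)
    have h1 := F.lam_lo1 t ⟨ht.1, by linarith [ht.2]⟩
    have h2 := F.fac (k - 3 * q ^ 2 / ε * (t - T0))
    have h3 : 3 * q ^ 2 / ε * (t - T0) ≤ q := by
      rw [div_mul_eq_mul_div, div_le_iff₀ hε]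
      have : t - T0 ≤ s / 3 := by linarith [ht.2]
      rw [hsq]
      nlinarith
    have h4 : 0 ≤ 3 * q ^ 2 / ε * (t - T0) := by
      have : 0 ≤ t - T0 := by linarith [ht.1]
      positivity
    set b := 3 * q ^ 2 / ε * (t - T0)
    rw [le_div_iff₀ hε]
    have h5 : -(3 * q ^ 2 / ε * 1) * ε = -(3 * q ^ 2) := by field_simp
    have h6 : ρ * (t - T0) ≤ q ^ 2 / 3 := by
      have : t - T0 ≤ s / 3 := by linarith [ht.2]
      nlinarith
    rw [h5]
    have h7 : (k - b - k) ^ 2 * (k - b + 2 * k) ≤ q ^ 2 * 2 := by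
      have : (k - b - k) ^ 2 = b ^ 2 := by ring
      rw [this]
      apply mul_le_mul _ (by linarith) (by linarith) (by positivity)
      nlinarith
    nlinarith [sq_nonneg q]
  intro t ht
  have h1 := key t ht
  have h3 : 3 * q ^ 2 / ε * (t - T0) ≤ q := by
    rw [div_mul_eq_mul_div, div_le_iff₀ hε]
    have : t - T0 ≤ s / 3 := by linarith [ht.2]
    rw [hsq]
    nlinarith
  linarith


end Hyst


namespace Hyst

lemma dist_der {ε a b : ℝ} {lam x y : ℝ → ℝ} (hx : IsSol ε lam x a b) (hy : IsSol ε lam y a b) :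
    ∀ t ∈ Icc a b, HasDerivAt (fun t => (x t - y t) ^ 2)
      (2 * (1 - (x t ^ 2 + x t * y t + y t ^ 2)) / ε * (x t - y t) ^ 2) t := by
  intro t ht
  have h := ((hx t ht).sub (hy t ht)).pow 2
  refine h.congr_deriv ?_
  simp only [Pi.sub_apply]
  push_cast
  ring

lemma dist_growth {ε a b : ℝ} {lam x y : ℝ → ℝ} (hε : 0 < ε) (hab : a ≤ b)
    (hx : IsSol ε lam x a b) (hy : IsSol ε lam y a b) :
    (x b - y b) ^ 2 ≤ (x a - y a) ^ 2 * exp (2 / ε * (b - a)) := by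
  refine gron (y := fun t => (x t - y t) ^ 2) hab (dist_der hx hy) ?_
  intro t ht
  apply mul_le_mul_of_nonneg_right _ (sq_nonneg _)
  apply div_le_div_of_nonneg_right _ hε.le
  nlinarith [sq_nonneg (x t + y t), sq_nonneg (x t), sq_nonneg (y t)]


lemma Frc.contr {k T0 ρ : ℝ} {lam lam' : ℝ → ℝ} (F : Frc k T0 ρ lam lam')
    {ε q : ℝ} (P : Par ε ρ q) {x y : ℝ → ℝ}
    (hx : IsSol ε lam x T0 (T0 + 1 / 2)) (hy : IsSol ε lam y T0 (T0 + 1 / 2)) :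
    (x (T0 + 1 / 2) - y (T0 + 1 / 2)) ^ 2 ≤ (x T0 - y T0) ^ 2 * exp (-(1 / (2 * ε))) := by
  have hs := P.s_pos
  have hsl := P.s_le
  have hss := P.s_small
  have hε := P.ε_pos
  have hT := F.T0rho
  have hT4 := F.T0lo
  have hr := F.rpos
  have hk := F.klo
  have hk2 := F.khi
  have hk3 := F.k3
  have jx := F.jump P (hx.mono le_rfl (by linarith))
  have jy := F.jump P (hy.mono le_rfl (by linarith))
  set s := ε / q with hsdef
  set Tm := T0 + 25 * s with hTm
  have hTm0 : Tm ≤ 0 := by linarith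
  have hTm1 : T0 ≤ Tm := by linarith
  have nx := F.upper_neg1 (a := Tm) (b := 1 / 4) hε (hx.mono hTm1 (by linarith)) hTm1 le_rfl jx
  have ny := F.upper_neg1 (a := Tm) (b := 1 / 4) hε (hy.mono hTm1 (by linarith)) hTm1 le_rfl jy
  have kx := F.upper_negk (a := Tm) (b := T0 + 1 / 2) hε (hx.mono hTm1 (by linarith)) hTm1 le_rfl
    (by linarith)
  have ky := F.upper_negk (a := Tm) (b := T0 + 1 / 2) hε (hy.mono hTm1 (by linarith)) hTm1 le_rfl
    (by linarith)
  have d1 := dist_growth hε hTm1 (hx.mono le_rfl (by linarith)) (hy.mono le_rfl (by linarith))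
  have d2 : (x (1 / 4) - y (1 / 4)) ^ 2 ≤ (x Tm - y Tm) ^ 2 * exp (-4 / ε * (1 / 4 - Tm)) := by
    refine gron (y := fun t => (x t - y t) ^ 2) (by linarith)
      (dist_der (hx.mono hTm1 (by linarith)) (hy.mono hTm1 (by linarith))) ?_
    intro t ht
    apply mul_le_mul_of_nonneg_right _ (sq_nonneg _)
    apply div_le_div_of_nonneg_right _ hε.le
    have h1 := nx t ht
    have h2 := ny t ht
    nlinarith
  have d3 : (x (T0 + 1 / 2) - y (T0 + 1 / 2)) ^ 2
      ≤ (x (1 / 4) - y (1 / 4)) ^ 2 * exp (0 * (T0 + 1 / 2 - 1 / 4)) := by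
    refine gron (y := fun t => (x t - y t) ^ 2) (by linarith)
      (dist_der (hx.mono (by linarith) (by linarith)) (hy.mono (by linarith) (by linarith))) ?_
    intro t ht
    apply mul_le_mul_of_nonneg_right _ (sq_nonneg _)
    apply div_nonpos_of_nonpos_of_nonneg _ hε.le
    have h1 := kx t ⟨by linarith [ht.1], ht.2⟩
    have h2 := ky t ⟨by linarith [ht.1], ht.2⟩
    nlinarith
  rw [zero_mul, exp_zero, mul_one] at d3
  calc _ ≤ _ := d3
    _ ≤ _ := d2
    _ ≤ ((x T0 - y T0) ^ 2 * exp (2 / ε * (Tm - T0))) * exp (-4 / ε * (1 / 4 - Tm)) :=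
      mul_le_mul_of_nonneg_right d1 (exp_pos _).le
    _ = (x T0 - y T0) ^ 2 * exp (2 / ε * (Tm - T0) + -4 / ε * (1 / 4 - Tm)) := by
      rw [mul_assoc, exp_add]
    _ ≤ _ := by
      apply mul_le_mul_of_nonneg_left _ (sq_nonneg _)
      apply exp_le_exp.2
      have : 2 / ε * (Tm - T0) + -4 / ε * (1 / 4 - Tm) = (50 * s - 1 + 4 * Tm) / ε := by
        rw [hTm]; field_simp; ring
      rw [this, show -(1 / (2 * ε)) = (-(1 / 2)) / ε by field_simp]
      apply div_le_div_of_nonneg_right _ hε.le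
      linarith

/-- the primitive of the static right-hand side at the lower fold. -/
noncomputable def W (k x : ℝ) : ℝ := x ^ 2 / 2 - x ^ 4 / 4 - 2 * k / 3 * x

lemma Frc.W_k {k T0 ρ : ℝ} {lam lam' : ℝ → ℝ} (F : Frc k T0 ρ lam lam')
    (x : ℝ) : W k x - W k k = -((x - k) ^ 4 / 4 + k * (x - k) ^ 3) := by
  have h := F.k3
  have h3 : 3 * k ^ 3 = k := by linear_combination k * h
  have h4 : 3 * k ^ 4 = k ^ 2 := by linear_combination k ^ 2 * h
  unfold W
  linear_combination (-x ^ 2 / 2) * h + (2 * x / 3) * h3 - (1 / 6) * h4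

lemma Frc.W_2k {k T0 ρ : ℝ} {lam lam' : ℝ → ℝ} (F : Frc k T0 ρ lam lam')
    (x : ℝ) : W k x - W k (-2 * k) =
    -((x + 2 * k) ^ 4 / 4 - 2 * k * (x + 2 * k) ^ 3 + 3 / 2 * (x + 2 * k) ^ 2) := by
  have h := F.k3
  have h3 : 3 * k ^ 3 = k := by linear_combination k * h
  have h4 : 3 * k ^ 4 = k ^ 2 := by linear_combination k ^ 2 * h
  unfold W
  linear_combination (-16 / 3 * x) * h3 - 2 * x ^ 2 * h - (8 / 3) * h4

lemma Frc.W_diff {k T0 ρ : ℝ} {lam lam' : ℝ → ℝ} (F : Frc k T0 ρ lam lam')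
    : W k (-2 * k) - W k k = 3 / 4 := by
  have h := F.k3
  have h4 : 3 * k ^ 4 = k ^ 2 := by linear_combination k ^ 2 * h
  unfold W
  linear_combination (-5 / 4) * h4 + (3 / 4) * h


end Hyst


namespace Hyst

lemma p_der {ε a b : ℝ} {lam lam' x : ℝ → ℝ} (hl : ∀ t, HasDerivAt lam (lam' t) t)
    (hx : IsSol ε lam x a b) :
    ∀ t ∈ Icc a b, HasDerivAt (fun t => x t - x t ^ 3 + lam t)
      (lam' t + (1 - 3 * x t ^ 2) / ε * (x t - x t ^ 3 + lam t)) t := by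
  intro t ht
  have h := ((hx t ht).sub ((hx t ht).pow 3)).add (hl t)
  refine h.congr_deriv ?_
  push_cast
  ring

/-- `Phi' = p²/ε`. -/
lemma Phi_der {ε a b : ℝ} {lam lam' x J : ℝ → ℝ} (hl : ∀ t, HasDerivAt lam (lam' t) t)
    (hx : IsSol ε lam x a b) (hJ : ∀ t ∈ Icc a b, HasDerivAt J (x t * lam' t) t) :
    ∀ t ∈ Icc a b, HasDerivAt (fun t => -J t + x t * lam t + x t ^ 2 / 2 - x t ^ 4 / 4)
      ((x t - x t ^ 3 + lam t) * ((x t - x t ^ 3 + lam t) / ε)) t := by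
  intro t ht
  have h := (((hJ t ht).neg.add ((hx t ht).mul (hl t))).add (((hx t ht).pow 2).div_const 2)).sub
    (((hx t ht).pow 4).div_const 4)
  refine h.congr_deriv ?_
  push_cast
  ring

lemma W_der {ε a b k : ℝ} {lam x : ℝ → ℝ} (hx : IsSol ε lam x a b) :
    ∀ t ∈ Icc a b, HasDerivAt (fun t => W k (x t))
      ((x t - x t ^ 3 - 2 * k / 3) * ((x t - x t ^ 3 + lam t) / ε)) t := by
  intro t ht
  have h := ((((hx t ht).pow 2).div_const 2).sub (((hx t ht).pow 4).div_const 4)).sub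
    ((hx t ht).const_mul (2 * k / 3))
  refine h.congr_deriv ?_
  push_cast
  ring

lemma exp_q {q : ℝ} (hq : 0 < q) : exp (-2 / q) ≤ q / 2 := by
  have h := add_one_le_exp (2 / q)
  have h2 : exp (-2 / q) = (exp (2 / q))⁻¹ := by rw [← exp_neg]; ring_nf
  rw [h2]
  have h3 : (2 / q) ≤ exp (2 / q) := by linarith
  calc (exp (2 / q))⁻¹ ≤ (2 / q)⁻¹ := inv_anti₀ (by positivity) h3
    _ = q / 2 := by rw [inv_div]


lemma Frc.p_neg {k T0 ρ : ℝ} {lam lam' : ℝ → ℝ} (F : Frc k T0 ρ lam lam')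
    {ε : ℝ} {x : ℝ → ℝ} (hε : 0 < ε)
    (hx : IsSol ε lam x T0 0) (h0 : -2 * k ≤ x T0) :
    ∀ t ∈ Icc T0 0, x t - x t ^ 3 + lam t ≤ 0 := by
  refine sgn_le (y := fun t => x t - x t ^ 3 + lam t) (K := 1 / ε) (p_der F.der hx) ?_ ?_
  · rw [F.lamT0]
    have := F.fac (x T0)
    have : 0 ≤ (x T0 - k) ^ 2 * (x T0 + 2 * k) := mul_nonneg (sq_nonneg _) (by linarith)
    linarith
  · intro t ht hpos
    have h1 := F.der_neg t ht
    have h2 : (1 - 3 * x t ^ 2) / ε ≤ 1 / ε :=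
      div_le_div_of_nonneg_right (by nlinarith [sq_nonneg (x t)]) hε.le
    nlinarith [mul_le_mul_of_nonneg_right h2 hpos.le]

/-- monotonicity in phase 1 -/
lemma Frc.x_anti {k T0 ρ : ℝ} {lam lam' : ℝ → ℝ} (F : Frc k T0 ρ lam lam')
    {ε : ℝ} {x : ℝ → ℝ} (hε : 0 < ε)
    (hx : IsSol ε lam x T0 0) (h0 : -2 * k ≤ x T0) :
    ∀ s t, T0 ≤ s → s ≤ t → t ≤ 0 → x t ≤ x s := by
  intro s t hs hst ht
  have := incr_le (f := x) (g := fun _ => (0:ℝ)) (g' := fun _ => 0) hst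
    (hx.mono hs ht) (fun s _ => hasDerivAt_const s _)
    (fun r hr => div_nonpos_of_nonpos_of_nonneg
      (F.p_neg hε hx h0 r ⟨hs.trans hr.1.le, hr.2.le.trans ht⟩) hε.le)
  linarith

set_option maxHeartbeats 1000000 in
/-- Lower bound for the area of half a cycle. -/
lemma Frc.area_lower {k T0 ρ : ℝ} {lam lam' : ℝ → ℝ} (F : Frc k T0 ρ lam lam')
    {ε q : ℝ} (P : Par ε ρ q) {x J : ℝ → ℝ}
    (hx : IsSol ε lam x T0 (T0 + 1 / 2)) (hJ : ∀ t ∈ Icc T0 (T0 + 1 / 2), HasDerivAt J (x t * lam' t) t)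
    (h0 : k ≤ x T0) (hper : x (T0 + 1 / 2) = -x T0) :
    q ^ 2 / 8 ≤ -(J (T0 + 1 / 2) - J T0) - 3 / 4 := by
  have hs := P.s_pos
  have hsl := P.s_le
  have hss := P.s_small
  have hrs := P.rs
  have hε := P.ε_pos
  have hq := P.q_pos
  have hT := F.T0rho
  have hT4 := F.T0lo
  have hr := F.rpos
  have hk := F.klo
  have hk2 := F.khi
  have hk3 := F.k3
  have jx := F.jump P (hx.mono le_rfl (by linarith))
  have dx := F.delay P (hx.mono le_rfl (by linarith)) h0
  have hsq : ε = q * (ε / q) := by field_simp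
  set s := ε / q with hsdef
  set Tm := T0 + 25 * s with hTm
  have hTm0 : Tm + s ≤ 0 := by linarith
  have hTm1 : T0 ≤ Tm := by linarith
  have hx1 : IsSol ε lam x T0 0 := hx.mono le_rfl (by linarith)
  have hpn := F.p_neg hε hx1 (by linarith)
  have hanti := F.x_anti hε hx1 (by linarith)
  have nx := F.upper_neg1 (a := Tm) (b := 1 / 4) hε (hx.mono hTm1 (by linarith)) hTm1 le_rfl jx
  have hΦ := Phi_der F.der hx hJ
  have hW := W_der (k := k) hx
  set Φ : ℝ → ℝ := fun t => -J t + x t * lam t + x t ^ 2 / 2 - x t ^ 4 / 4 with hΦdef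
  -- total
  have htot : Φ (T0 + 1 / 2) - Φ T0 = -(J (T0 + 1 / 2) - J T0) := by
    simp only [hΦdef]
    rw [hper, F.lamT0, F.lamtc]; ring
  -- choice of T1
  obtain ⟨T1, hT1a, hT1b, hT1c, hT1d⟩ : ∃ T1, T0 + s / 3 ≤ T1 ∧ T1 ≤ 0 ∧ x T1 ≤ -1 ∧
      W k (-2 * k) - q ^ 2 / 100 ≤ W k (x T1) := by
    rcases le_or_gt (x (Tm + s)) (-2 * k) with hcase | hcase
    · have hcont : ContinuousOn x (Icc (T0 + s / 3) (Tm + s)) := fun t ht =>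
        (hx t ⟨by linarith [ht.1], by linarith [ht.2]⟩).continuousAt.continuousWithinAt
      have hd := dx (T0 + s / 3) ⟨by linarith, le_rfl⟩
      obtain ⟨T1, hT1, hT1x⟩ := intermediate_value_Icc' (by linarith) hcont
        ⟨hcase, (by linarith : -2 * k ≤ x (T0 + s / 3))⟩
      refine ⟨T1, hT1.1, by linarith [hT1.2], by rw [hT1x]; linarith, ?_⟩
      rw [hT1x]
      nlinarith [sq_nonneg q]
    · refine ⟨Tm + s, by linarith, hTm0, nx _ ⟨by linarith, by linarith⟩, ?_⟩
      have hv : x (Tm + s) + 2 * k ≤ (x Tm + 2 * k) * exp (-2 / ε * (Tm + s - Tm)) := by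
        refine gron (y := fun t => x t + 2 * k) (by linarith)
          (fun t ht => (hx t ⟨by linarith [ht.1], by linarith [ht.2]⟩).add_const _) ?_
        intro t ht
        have h1 := nx t ⟨ht.1, by linarith [ht.2]⟩
        have h2 := F.fac (x t)
        have h3 := F.lam_hi1 t ⟨by linarith [ht.1], by linarith [ht.2]⟩
        have h4 : x (Tm + s) ≤ x t := hanti t (Tm + s) (by linarith [ht.1]) ht.2 hTm0
        rw [div_mul_eq_mul_div]
        apply div_le_div_of_nonneg_right _ hε.le
        have h5 : 2 ≤ (x t - k) ^ 2 := by nlinarith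
        nlinarith
      have he : -2 / ε * (Tm + s - Tm) = -2 / q := by
        rw [hsdef]; field_simp; ring
      rw [he] at hv
      have hexp := exp_q hq
      have hv2 : x (Tm + s) + 2 * k ≤ 0.08 * q := by
        have h6 : x Tm + 2 * k ≤ 0.16 := by linarith
        have h7 := exp_pos (-2 / q)
        nlinarith
      have hv0 : 0 < x (Tm + s) + 2 * k := by linarith
      have hWd := F.W_2k (x (Tm + s))
      set v := x (Tm + s) + 2 * k
      have h8 : v ^ 2 ≤ (0.08 * q) ^ 2 := by nlinarith
      have h9 : v ≤ 1 := by nlinarith [P.q_le]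
      have h10 : v ^ 4 / 4 - 2 * k * v ^ 3 ≤ 0 := by
        have : v ^ 4 / 4 - 2 * k * v ^ 3 = v ^ 3 * (v / 4 - 2 * k) := by ring
        rw [this]
        exact mul_nonpos_of_nonneg_of_nonpos (by positivity) (by linarith)
      nlinarith
  -- first piece
  have e1 : W k (x (T0 + s / 3)) - W k (x T0) ≤ Φ (T0 + s / 3) - Φ T0 := by
    refine incr_le (f := fun t => W k (x t)) (g := Φ) (by linarith)
      (fun t ht => hW t ⟨ht.1, by linarith [ht.2]⟩) (fun t ht => hΦ t ⟨ht.1, by linarith [ht.2]⟩) ?_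
    intro t ht
    have htm : t ∈ Icc T0 0 := ⟨ht.1.le, by linarith [ht.2]⟩
    have h1 : (x t - x t ^ 3 + lam t) / ε ≤ 0 := div_nonpos_of_nonpos_of_nonneg (hpn t htm) hε.le
    have h2 := F.lam_hi1 t htm
    exact mul_le_mul_of_nonpos_right (by linarith) h1
  have e2 : (W k (x T1) - q ^ 2 / 6 * x T1) - (W k (x (T0 + s / 3)) - q ^ 2 / 6 * x (T0 + s / 3))
      ≤ Φ T1 - Φ (T0 + s / 3) := by
    refine incr_le (f := fun t => W k (x t) - q ^ 2 / 6 * x t) (g := Φ) hT1a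
      (fun t ht => (hW t ⟨by linarith [ht.1], by linarith [ht.2]⟩).sub
        ((hx t ⟨by linarith [ht.1], by linarith [ht.2]⟩).const_mul (q ^ 2 / 6)))
      (fun t ht => hΦ t ⟨by linarith [ht.1], by linarith [ht.2]⟩) ?_
    intro t ht
    have htm : t ∈ Icc T0 0 := ⟨by linarith [ht.1], by linarith [ht.2]⟩
    have h1 : (x t - x t ^ 3 + lam t) / ε ≤ 0 := div_nonpos_of_nonpos_of_nonneg (hpn t htm) hε.le
    have h2 := F.lam_hi2 (c := s / 3) (by linarith) (by linarith) t ⟨ht.1.le, by linarith [ht.2]⟩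
    have h3 : ρ / 2 * (s / 3) = q ^ 2 / 6 := by rw [← hrs]; ring
    have h4 : x t - x t ^ 3 + lam t ≤ (x t - x t ^ 3 - 2 * k / 3) - q ^ 2 / 6 := by linarith
    have h5 := mul_le_mul_of_nonpos_right h4 h1
    rw [sub_mul] at h5
    exact h5
  have e3 : 0 - 0 ≤ Φ (T0 + 1 / 2) - Φ T1 := by
    refine incr_le (f := fun t => 0) (f' := fun _ => 0) (g := Φ) (by linarith)
      (fun t ht => hasDerivAt_const _ _) (fun t ht => hΦ t ⟨by linarith [ht.1], by linarith [ht.2]⟩) ?_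
    intro t ht
    rw [← mul_div_assoc]
    exact div_nonneg (mul_self_nonneg _) hε.le
  have e4 : W k (x T0) ≤ W k k := by
    have := F.W_k (x T0)
    have h5 : 0 ≤ x T0 - k := by linarith
    have : 0 ≤ (x T0 - k) ^ 4 / 4 + k * (x T0 - k) ^ 3 := by positivity
    linarith
  have e5 := F.W_diff
  have e6 := dx (T0 + s / 3) ⟨by linarith, le_rfl⟩
  have e7 : q ^ 2 / 6 ≤ q ^ 2 / 6 * (x (T0 + s / 3) - x T1) := by
    have h6 : 1 ≤ x (T0 + s / 3) - x T1 := by linarith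
    have h7 := mul_le_mul_of_nonneg_left h6 (by positivity : 0 ≤ q ^ 2 / 6)
    linarith
  have e8 : 0 ≤ q ^ 2 := sq_nonneg q
  rw [mul_sub] at e7
  linarith


end Hyst


namespace Hyst


lemma Frc.p_le {k T0 ρ : ℝ} {lam lam' : ℝ → ℝ} (F : Frc k T0 ρ lam lam')
    {ε q : ℝ} (P : Par ε ρ q) {x : ℝ → ℝ}
    (hx : IsSol ε lam x 0 (T0 + 1 / 2)) (hxk : ∀ t ∈ Icc 0 (T0 + 1 / 2), x t ≤ -k)
    (h0 : x 0 - x 0 ^ 3 + lam 0 ≤ 0) :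
    ∀ t ∈ Icc 0 (T0 + 1 / 2), x t - x t ^ 3 + lam t ≤ q ^ 2 := by
  have hε := P.ε_pos
  have hq := P.q_pos
  have hk := F.klo
  have hk2 := F.khi
  have hk3 := F.k3
  have hT4 := F.T0neg
  have key := sgn_le (y := fun t => x t - x t ^ 3 + lam t - q ^ 2) (K := 0)
    (fun t ht => (p_der F.der hx t ht).sub_const _) (by nlinarith [sq_nonneg q]) ?_
  · intro t ht
    have := key t ht
    linarith
  intro t ht hpos
  have h1 := hxk t ht
  have h2 := F.der_pos t ht
  have h3 := F.der_sq t ht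
  have h4 := F.lam_le t ⟨by linarith [ht.1], ht.2⟩
  have h5 := F.fac' (x t)
  set p := x t - x t ^ 3 + lam t with hp
  obtain ⟨v, hv⟩ : ∃ v, v = -k - x t := ⟨_, rfl⟩
  have hv0 : 0 ≤ v := by linarith
  have hxv : x t = -k - v := by linarith
  obtain ⟨a, ha⟩ : ∃ a, a = 3 * x t ^ 2 - 1 := ⟨_, rfl⟩
  have hav : a = 3 * v * (2 * k + v) := by rw [ha, hxv]; linear_combination hk3
  have ha0 : 0 ≤ a := by rw [hav]; positivity
  obtain ⟨δ, hδ⟩ : ∃ δ, δ = 2 * k / 3 - lam t := ⟨_, rfl⟩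
  have hδ0 : 0 ≤ δ := by linarith
  have h6 : δ + p = v ^ 2 * (v + 3 * k) := by
    have : δ + p = x t - x t ^ 3 + 2 * k / 3 := by rw [hδ, hp]; ring
    rw [this, h5, hxv]; ring
  have h7 : 6 * (δ + p) ≤ a ^ 2 := by
    rw [h6, hav]
    have h8 : 6 * (v + 3 * k) ≤ 9 * (2 * k + v) ^ 2 := by nlinarith
    have := mul_le_mul_of_nonneg_left h8 (sq_nonneg v)
    nlinarith
  have hpq : q ^ 2 < p := by linarith
  have hp0 : 0 < p := lt_trans (by positivity) hpq
  have h9 : lam' t * ε ≤ a * p := by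
    rw [← pow_le_pow_iff_left₀ (by positivity) (by positivity) two_ne_zero]
    have e1 : (lam' t * ε) ^ 2 ≤ (ρ ^ 2 + 31 * δ) * ε ^ 2 := by
      rw [mul_pow]
      refine mul_le_mul_of_nonneg_right ?_ (sq_nonneg _)
      rw [hδ]; exact h3
    have e2 : 6 * (δ + q ^ 2) * (q ^ 2) ^ 2 ≤ (a * p) ^ 2 := by
      rw [mul_pow]
      apply mul_le_mul (by linarith) _ (by positivity) (sq_nonneg _)
      exact pow_le_pow_left₀ (by positivity) hpq.le 2
    have e3 : ρ ^ 2 * ε ^ 2 = q ^ 6 := by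
      have := P.q3
      calc ρ ^ 2 * ε ^ 2 = (ε * ρ) ^ 2 := by ring
        _ = q ^ 6 := by rw [← this]; ring
    have e4 : 10000 * ε ^ 2 ≤ q ^ 4 := by
      have := P.hM
      have := pow_le_pow_left₀ (by positivity) this 2
      calc _ = (100 * ε) ^ 2 := by ring
        _ ≤ (q ^ 2) ^ 2 := this
        _ = q ^ 4 := by ring
    have e5 : 31 * δ * ε ^ 2 ≤ 6 * δ * q ^ 4 := by
      have : 31 * ε ^ 2 ≤ 6 * q ^ 4 := by nlinarith [sq_nonneg ε]
      have := mul_le_mul_of_nonneg_left this hδ0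
      linarith
    have e6 : 0 ≤ q ^ 6 := by positivity
    calc (lam' t * ε) ^ 2 ≤ (ρ ^ 2 + 31 * δ) * ε ^ 2 := e1
      _ = q ^ 6 + 31 * δ * ε ^ 2 := by rw [add_mul, e3]
      _ ≤ 6 * q ^ 6 + 6 * δ * q ^ 4 := by linarith
      _ = 6 * (δ + q ^ 2) * (q ^ 2) ^ 2 := by ring
      _ ≤ _ := e2
  have h10 : (1 - 3 * x t ^ 2) / ε * p = -(a * p / ε) := by rw [ha]; ring
  rw [h10]
  have h11 : lam' t ≤ a * p / ε := (le_div_iff₀ hε).2 h9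
  linarith

set_option maxHeartbeats 8000000 in
/-- Upper bound for the area of half a cycle. -/
lemma Frc.area_upper {k T0 ρ : ℝ} {lam lam' : ℝ → ℝ} (F : Frc k T0 ρ lam lam')
    {ε q : ℝ} (P : Par ε ρ q) {x J : ℝ → ℝ}
    (hx : IsSol ε lam x T0 (T0 + 1 / 2)) (hJ : ∀ t ∈ Icc T0 (T0 + 1 / 2), HasDerivAt J (x t * lam' t) t)
    (h0 : k ≤ x T0) (h02 : x T0 ≤ 2) (hper : x (T0 + 1 / 2) = -x T0) :
    -(J (T0 + 1 / 2) - J T0) - 3 / 4 ≤ 200 * q ^ 2 := by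
  have hs := P.s_pos
  have hsl := P.s_le
  have hss := P.s_small
  have hrs := P.rs
  have hε := P.ε_pos
  have hq := P.q_pos
  have hq1 := P.q_le
  have hT := F.T0rho
  have hT4 := F.T0lo
  have hr := F.rpos
  have hr5 := F.rle
  have hk := F.klo
  have hk2 := F.khi
  have hk3 := F.k3
  have hq3 := P.q3
  have jx := F.jump P (hx.mono le_rfl (by linarith))
  have hsq : ε = q * (ε / q) := by field_simp
  set s := ε / q with hsdef
  set Tm := T0 + 25 * s with hTm
  set T2 := Tm + s with hT2
  set tc := T0 + 1 / 2 with htc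
  have hTm0 : T2 ≤ 0 := by linarith
  have hTm1 : T0 ≤ Tm := by linarith
  have htcpos : 1 / 4 < tc := by linarith
  have hx1 : IsSol ε lam x T0 0 := hx.mono le_rfl (by linarith)
  have hpn := F.p_neg hε hx1 (by linarith)
  have hanti := F.x_anti hε hx1 (by linarith)
  have hb2 := F.upper2 hε hx h02
  have hl2 := F.lower2 hε hx (by linarith)
  have nx := F.upper_neg1 (a := Tm) (b := 1 / 4) hε (hx.mono hTm1 (by linarith)) hTm1 le_rfl jx
  have nk := F.upper_negk (a := Tm) (b := tc) hε (hx.mono hTm1 (by linarith)) hTm1 le_rfl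
    (by linarith)
  have hple := F.p_le P (hx.mono (by linarith) le_rfl)
    (fun t ht => nk t ⟨by linarith [ht.1], ht.2⟩) (hpn 0 ⟨by linarith, le_rfl⟩)
  have hΦ := Phi_der F.der hx hJ
  have hp := p_der F.der hx
  have hW := W_der (k := k) hx
  set Φ : ℝ → ℝ := fun t => -J t + x t * lam t + x t ^ 2 / 2 - x t ^ 4 / 4 with hΦdef
  have htot : Φ tc - Φ T0 = -(J tc - J T0) := by
    simp only [hΦdef]
    rw [hper, F.lamT0, F.lamtc]; ring
  set p : ℝ → ℝ := fun t => x t - x t ^ 3 + lam t with hpdef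
  have hqq : 0 < q ^ 2 := by positivity
  -- first piece
  have e1 : Φ T2 - Φ T0 ≤ (W k (x T2) - 26 * q ^ 2 * x T2) - (W k (x T0) - 26 * q ^ 2 * x T0) := by
    refine incr_le (f := Φ) (g := fun t => W k (x t) - 26 * q ^ 2 * x t) (by linarith)
      (fun t ht => hΦ t ⟨by linarith [ht.1], by linarith [ht.2]⟩)
      (fun t ht => (hW t ⟨by linarith [ht.1], by linarith [ht.2]⟩).sub
        ((hx t ⟨by linarith [ht.1], by linarith [ht.2]⟩).const_mul (26 * q ^ 2))) ?_
    intro t ht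
    have htm : t ∈ Icc T0 0 := ⟨by linarith [ht.1], by linarith [ht.2]⟩
    have h1 : (x t - x t ^ 3 + lam t) / ε ≤ 0 := div_nonpos_of_nonpos_of_nonneg (hpn t htm) hε.le
    have h2 := F.lam_lo1 t htm
    have h3 : ρ * (t - T0) ≤ 26 * q ^ 2 := by
      have : t - T0 ≤ 26 * s := by linarith [ht.2]
      have := mul_le_mul_of_nonneg_left this hr.le
      linarith
    have h4 : (x t - x t ^ 3 - 2 * k / 3) - 26 * q ^ 2 ≤ x t - x t ^ 3 + lam t := by linarith
    have h5 := mul_le_mul_of_nonpos_right h4 h1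
    rw [sub_mul] at h5
    exact h5
  have e1' : W k (x T2) ≤ W k (-2 * k) := by
    have hWd := F.W_2k (x T2)
    obtain ⟨v, hv⟩ : ∃ v, v = x T2 + 2 * k := ⟨_, rfl⟩
    rw [← hv] at hWd
    have hv1 : v ≤ 0.156 := by
      have := nx T2 ⟨by linarith, by linarith⟩
      linarith
    have : 0 ≤ v ^ 2 * (v ^ 2 / 4 - 2 * k * v + 3 / 2) := by
      apply mul_nonneg (sq_nonneg _)
      nlinarith [sq_nonneg (v - 4 * k)]
    nlinarith
  have e1'' : W k k - W k (x T0) ≤ 2 * q ^ 2 := by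
    have h1 := F.W_k (x T0)
    have h2 := hple tc ⟨by linarith, le_rfl⟩
    rw [F.lamtc, F.fac', hper] at h2
    obtain ⟨y, hy⟩ : ∃ y, y = x T0 - k := ⟨_, rfl⟩
    rw [← hy] at h1
    have hxy : x T0 = k + y := by linarith
    have hy0 : 0 ≤ y := by linarith
    have hy2 : y ≤ 2 := by linarith
    rw [hxy] at h2
    have h3 : y ^ 2 * (y + 3 * k) ≤ q ^ 2 := by nlinarith
    have h4 : y * (y ^ 2 * (y + 3 * k)) ≤ 2 * q ^ 2 := mul_le_mul hy2 h3 (by positivity) (by norm_num)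
    have h5 : y ^ 4 / 4 + k * y ^ 3 ≤ y * (y ^ 2 * (y + 3 * k)) := by
      have : 0 ≤ 3 / 4 * y ^ 4 + 2 * k * y ^ 3 := by positivity
      nlinarith
    linarith
  -- size of p at T2
  have e2 : -p T2 ≤ q := by
    have hv : -p T2 - ε * ρ / 2 ≤ (-p Tm - ε * ρ / 2) * exp (-2 / ε * (T2 - Tm)) := by
      refine gron (y := fun t => -p t - ε * ρ / 2) (by linarith)
        (fun t ht => (hp t ⟨by linarith [ht.1], by linarith [ht.2]⟩).neg.sub_const _) ?_
      intro t ht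
      have h1 := nx t ⟨ht.1, by linarith [ht.2]⟩
      have htm : t ∈ Icc T0 0 := ⟨by linarith [ht.1], by linarith [ht.2]⟩
      have h2 := F.der_lo t htm
      have h3 : p t ≤ 0 := hpn t htm
      have h4 : (1 - 3 * x t ^ 2) ≤ -2 := by nlinarith
      have h5 : (-2) * p t / ε ≤ (1 - 3 * x t ^ 2) * p t / ε :=
        div_le_div_of_nonneg_right (mul_le_mul_of_nonpos_right h4 h3) hε.le
      have h6 : -2 / ε * (-p t - ε * ρ / 2) = -((-2) * p t / ε) + ρ := by field_simp; ring
      rw [h6, div_mul_eq_mul_div]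
      linarith
    have he : -2 / ε * (T2 - Tm) = -2 / q := by
      rw [hT2, hsdef]; field_simp; ring
    rw [he] at hv
    have h7 := exp_pos (-2 / q)
    have hexp := exp_q hq
    have h8 : -p Tm - ε * ρ / 2 ≤ 1 := by
      have h9 := hl2 Tm ⟨hTm1, by linarith⟩
      have h10 := (abs_le.1 (F.lam_abs Tm)).1
      have h11 : 0 ≤ x Tm - x Tm ^ 3 := by nlinarith [mul_nonneg (by linarith : 0 ≤ -x Tm - 1) (by nlinarith : 0 ≤ x Tm * (x Tm - 1))]
      have h12 : 0 < ε * ρ := by positivity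
      simp only [hpdef]
      linarith
    have h13 := mul_le_mul_of_nonneg_right h8 h7.le
    have h14 : ε * ρ ≤ q := by
      rw [← hq3]; nlinarith
    linarith
  have e2n : p T2 ≤ 0 := hpn T2 ⟨by linarith, hTm0⟩
  -- the time when p becomes nonnegative
  have hpc : ContinuousOn p (Icc 0 tc) := fun t ht =>
    (hp t ⟨by linarith [ht.1], ht.2⟩).continuousAt.continuousWithinAt
  obtain ⟨Ts, hTs⟩ : ∃ Ts, IsLeast (Icc 0 tc ∩ p ⁻¹' (Ici 0)) Ts := by
    refine IsCompact.exists_isLeast ?_ ?_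
    · exact isCompact_Icc.of_isClosed_subset (hpc.preimage_isClosed_of_isClosed isClosed_Icc isClosed_Ici)
        inter_subset_left
    · refine ⟨tc, ⟨by linarith, le_rfl⟩, ?_⟩
      show 0 ≤ x tc - x tc ^ 3 + lam tc
      rw [F.lamtc, F.fac']
      have := nk tc ⟨by linarith, le_rfl⟩
      nlinarith [mul_nonneg (sq_nonneg (x tc + k)) (by linarith : 0 ≤ -(x tc - 2 * k))]
  obtain ⟨⟨⟨hTs0, hTs1⟩, hTsp⟩, hTsl⟩ := hTs
  have hbefore : ∀ t ∈ Icc T2 Ts, t < Ts → p t ≤ 0 := by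
    intro t ht hlt
    rcases le_or_gt t 0 with h | h
    · exact hpn t ⟨by linarith [ht.1], h⟩
    · by_contra hc
      push Not at hc
      have := hTsl ⟨⟨h.le, by linarith⟩, hc.le⟩
      linarith
  have hafter : ∀ t ∈ Icc Ts tc, 0 ≤ p t := by
    have := sgn_le (y := fun t => -p t) (a := Ts) (b := tc) (K := 0)
      (fun t ht => (hp t ⟨by linarith [ht.1], ht.2⟩).neg)
      (by have : 0 ≤ p Ts := hTsp
          linarith) ?_
    · intro t ht
      have := this t ht
      linarith
    · intro t ht hpos
      have h1 := F.der_pos t ⟨by linarith [ht.1], ht.2⟩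
      have h2 := nk t ⟨by linarith [ht.1], ht.2⟩
      have h3 : 1 - 3 * x t ^ 2 ≤ 0 := by nlinarith
      have h4 : 0 ≤ (1 - 3 * x t ^ 2) * p t := mul_nonneg_of_nonpos_of_nonpos h3 (by linarith)
      have h5 : 0 ≤ (1 - 3 * x t ^ 2) / ε * p t := by
        rw [div_mul_eq_mul_div]; exact div_nonneg h4 hε.le
      show -(lam' t + (1 - 3 * x t ^ 2) / ε * p t) ≤ 0 * (-p t)
      linarith
  have hxTs : ∀ t ∈ Icc T2 Ts, x t ≤ -1 := by
    intro t ht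
    have := incr_le (f := x) (g := fun _ => (0:ℝ)) (g' := fun _ => 0) ht.1
      (hx.mono (by linarith) (by linarith [ht.2])) (fun s _ => hasDerivAt_const s _)
      (fun r hr => div_nonpos_of_nonpos_of_nonneg
        (hbefore r ⟨hr.1.le, by linarith [hr.2, ht.2]⟩ (by linarith [hr.2, ht.2])) hε.le)
    have h1 := nx T2 ⟨by linarith, by linarith⟩
    linarith
  have e3 : Φ Ts - Φ T2 ≤ (ε * ρ ^ 2 / 4 * Ts - p Ts ^ 2 / 2) - (ε * ρ ^ 2 / 4 * T2 - p T2 ^ 2 / 2) := by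
    refine incr_le (f := Φ) (g := fun t => ε * ρ ^ 2 / 4 * t - p t ^ 2 / 2) (by linarith)
      (fun t ht => hΦ t ⟨by linarith [ht.1], by linarith [ht.2]⟩)
      (fun t ht => ((hasDerivAt_id t).const_mul (ε * ρ ^ 2 / 4)).sub
        (((hp t ⟨by linarith [ht.1], by linarith [ht.2]⟩).pow 2).div_const 2)) ?_
    intro t ht
    have h1 := hxTs t ⟨ht.1.le, ht.2.le⟩
    have h2 : p t ≤ 0 := hbefore t ⟨ht.1.le, ht.2.le⟩ ht.2
    have h3 : p t * lam' t ≤ p t ^ 2 / ε + ε * ρ ^ 2 / 4 := by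
      rcases le_or_gt t 0 with h | h
      · have h4 := F.der_lo t ⟨by linarith [ht.1], h⟩
        have h5 : p t * lam' t ≤ -p t * ρ := by
            have := mul_le_mul_of_nonpos_left h4 h2
            linarith
        have h6 : -p t * ρ ≤ p t ^ 2 / ε + ε * ρ ^ 2 / 4 := by
          have : p t ^ 2 / ε + ε * ρ ^ 2 / 4 - (-p t * ρ) = (p t + ε * ρ / 2) ^ 2 / ε := by
            field_simp; ring
          have : 0 ≤ (p t + ε * ρ / 2) ^ 2 / ε := by positivity
          linarith
        linarith
      · have h4 := F.der_pos t ⟨h.le, by linarith [ht.2]⟩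
        have h5 : p t * lam' t ≤ 0 := mul_nonpos_of_nonpos_of_nonneg h2 h4
        have : 0 ≤ p t ^ 2 / ε + ε * ρ ^ 2 / 4 := by positivity
        linarith
    have h4 : 1 - 3 * x t ^ 2 ≤ -2 := by nlinarith
    have h7 : (1 - 3 * x t ^ 2) * (p t ^ 2 / ε) ≤ -2 * (p t ^ 2 / ε) :=
      mul_le_mul_of_nonneg_right h4 (by positivity)
    have h8 : p t * (p t / ε) = p t ^ 2 / ε := by ring
    show p t * (p t / ε) ≤ ε * ρ ^ 2 / 4 * 1 - (((2:ℕ):ℝ) * p t ^ (2 - 1) * (lam' t + (1 - 3 * x t ^ 2) / ε * p t)) / 2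
    have h9 : (((2:ℕ):ℝ) * p t ^ (2 - 1) * (lam' t + (1 - 3 * x t ^ 2) / ε * p t)) / 2
        = p t * lam' t + (1 - 3 * x t ^ 2) * (p t ^ 2 / ε) := by
      push_cast; ring
    rw [h8, h9]
    linarith
  have e4 : Φ tc - Φ Ts ≤ q ^ 2 * x tc - q ^ 2 * x Ts := by
    refine incr_le (f := Φ) (g := fun t => q ^ 2 * x t) hTs1
      (fun t ht => hΦ t ⟨by linarith [ht.1], by linarith [ht.2]⟩)
      (fun t ht => (hx t ⟨by linarith [ht.1], by linarith [ht.2]⟩).const_mul (q ^ 2)) ?_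
    intro t ht
    exact mul_le_mul_of_nonneg_right (hple t ⟨by linarith [ht.1], ht.2.le⟩)
      (div_nonneg (hafter t ⟨ht.1.le, ht.2.le⟩) hε.le)
  have f1 : p T2 ^ 2 ≤ q ^ 2 := sq_le_sq' (by linarith) (by linarith)
  have f2 : ε * ρ ^ 2 / 4 * (Ts - T2) ≤ q ^ 2 := by
    have : ε * ρ ^ 2 ≤ q ^ 2 := by
      have : ε * ρ ^ 2 = q ^ 3 * ρ := by rw [hq3]; ring
      rw [this]
      have : q ^ 3 * ρ ≤ q ^ 3 * 5 := mul_le_mul_of_nonneg_left hr5 (by positivity)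
      have : q ^ 2 * q ≤ q ^ 2 * (1 / 100) := mul_le_mul_of_nonneg_left hq1 (by positivity)
      have e : q ^ 3 = q ^ 2 * q := by ring
      linarith
    have h2 : Ts - T2 ≤ 1 := by linarith
    have h3 : ε * ρ ^ 2 / 4 * (Ts - T2) ≤ ε * ρ ^ 2 / 4 * 1 :=
      mul_le_mul_of_nonneg_left h2 (by positivity)
    linarith
  have f3 : 26 * q ^ 2 * (x T0 - x T2) ≤ 26 * q ^ 2 * 4 := by
    apply mul_le_mul_of_nonneg_left _ (by positivity)
    have := hl2 T2 ⟨by linarith, by linarith⟩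
    linarith
  have f4 : q ^ 2 * (x tc - x Ts) ≤ q ^ 2 * 4 := by
    apply mul_le_mul_of_nonneg_left _ (by positivity)
    have := hl2 Ts ⟨by linarith, by linarith⟩
    have := hb2 tc ⟨by linarith, by linarith⟩
    linarith
  have f5 := F.W_diff
  have f6 : 0 ≤ p Ts ^ 2 := sq_nonneg _
  rw [mul_sub] at f2 f3 f4
  linarith


end Hyst


namespace Hyst

/-- clamp to `[-2,2]` -/
noncomputable def clp (x : ℝ) : ℝ := max (min x 2) (-2)

lemma clp_abs (x : ℝ) : |clp x| ≤ 2 :=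
  abs_le.2 ⟨le_max_right _ _, max_le (min_le_right _ _) (by norm_num)⟩

lemma clp_of {x : ℝ} (h : |x| ≤ 2) : clp x = x := by
  obtain ⟨h1, h2⟩ := abs_le.1 h
  unfold clp
  rw [min_eq_left h2, max_eq_left h1]

lemma clp_hi {x : ℝ} (h : 2 ≤ x) : clp x = 2 := by
  unfold clp
  rw [min_eq_right h, max_eq_left (by norm_num)]

lemma clp_lo {x : ℝ} (h : x ≤ -2) : clp x = -2 := by
  unfold clp
  rw [max_eq_right ((min_le_left _ _).trans h)]

lemma clp_neg (x : ℝ) : clp (-x) = -clp x := by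
  rcases le_or_gt 2 x with h | h
  · rw [clp_hi h, clp_lo (by linarith)]
  · rcases le_or_gt x (-2) with h2 | h2
    · rw [clp_lo h2, clp_hi (by linarith)]; norm_num
    · rw [clp_of (abs_le.2 ⟨by linarith, by linarith⟩),
        clp_of (abs_le.2 ⟨by linarith, by linarith⟩)]

lemma clp_lip (x y : ℝ) : |clp x - clp y| ≤ |x - y| := by
  unfold clp
  refine (abs_max_sub_max_le_abs _ _ _).trans ?_
  have h := abs_min_sub_min_le_max x 2 y 2
  simpa using h

/-- clamped vector field -/
noncomputable def Fc (ε : ℝ) (lam : ℝ → ℝ) (t x : ℝ) : ℝ := (clp x - clp x ^ 3 + lam t) / ε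

lemma Fc_lip {ε : ℝ} (hε : 0 < ε) (lam : ℝ → ℝ) (t : ℝ) :
    LipschitzWith (13 / ε).toNNReal (Fc ε lam t) := by
  refine LipschitzWith.of_dist_le_mul fun x y => ?_
  rw [Real.coe_toNNReal _ (by positivity), Real.dist_eq, Real.dist_eq]
  have h : Fc ε lam t x - Fc ε lam t y =
      (clp x - clp y) * (1 - (clp x ^ 2 + clp x * clp y + clp y ^ 2)) / ε := by
    unfold Fc; ring
  rw [h, abs_div, abs_mul, abs_of_pos hε, div_mul_eq_mul_div]
  apply div_le_div_of_nonneg_right _ hε.le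
  have h1 := clp_lip x y
  obtain ⟨hx1, hx2⟩ := abs_le.1 (clp_abs x)
  obtain ⟨hy1, hy2⟩ := abs_le.1 (clp_abs y)
  have h2 : |1 - (clp x ^ 2 + clp x * clp y + clp y ^ 2)| ≤ 13 := by
    rw [abs_le]
    constructor
    · nlinarith
    · nlinarith [sq_nonneg (clp x + clp y), sq_nonneg (clp x), sq_nonneg (clp y)]
  calc _ ≤ |x - y| * 13 := mul_le_mul h1 h2 (abs_nonneg _) (abs_nonneg _)
    _ = _ := by ring


lemma Frc.exists_cl {k T0 ρ : ℝ} {lam lam' : ℝ → ℝ} (F : Frc k T0 ρ lam lam')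
    {ε : ℝ} (hε : 0 < ε) (t₀ x₀ : ℝ) :
    ∃ x : ℝ → ℝ, x t₀ = x₀ ∧ ∀ t, HasDerivAt x (Fc ε lam t (x t)) t := by
  refine exists_global (F := Fc ε lam) (L := (11 / ε).toNNReal) (Fc_lip hε lam) ?_ ?_ t₀ x₀
  · intro x
    have : Continuous lam := continuous_iff_continuousAt.2 fun t => (F.der t).continuousAt
    unfold Fc
    fun_prop
  · intro t x
    rw [Real.coe_toNNReal _ (by positivity), Real.norm_eq_abs]
    unfold Fc
    rw [abs_div, abs_of_pos hε]
    apply div_le_div_of_nonneg_right _ hε.le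
    obtain ⟨h1, h2⟩ := abs_le.1 (clp_abs x)
    obtain ⟨h3, h4⟩ := abs_le.1 (F.lam_abs t)
    generalize clp x = c at *
    rw [abs_le]
    have e1 : c ^ 3 ≤ 8 := by nlinarith [sq_nonneg (c + 1), mul_nonneg (by linarith : 0 ≤ 2 - c) (by nlinarith [sq_nonneg (c + 1)] : 0 ≤ c ^ 2 + 2 * c + 4)]
    have e2 : -8 ≤ c ^ 3 := by nlinarith [sq_nonneg (c - 1), mul_nonneg (by linarith : 0 ≤ 2 + c) (by nlinarith [sq_nonneg (c - 1)] : 0 ≤ c ^ 2 - 2 * c + 4)]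
    constructor <;> linarith

lemma Frc.cl_stays {k T0 ρ : ℝ} {lam lam' : ℝ → ℝ} (F : Frc k T0 ρ lam lam')
    {ε a : ℝ} (hε : 0 < ε) {x : ℝ → ℝ}
    (hx : ∀ t, HasDerivAt x (Fc ε lam t (x t)) t) (h0 : |x a| ≤ 2) : ∀ t, a ≤ t → |x t| ≤ 2 := by
  intro t ht
  obtain ⟨h1, h2⟩ := abs_le.1 h0
  have u := sgn_le (y := fun t => x t - 2) (a := a) (b := t) (K := 0)
    (fun s _ => (hx s).sub_const _) (by linarith) (by
      intro s _ hpos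
      have h3 := (abs_le.1 (F.lam_abs s)).2
      rw [zero_mul]
      unfold Fc
      rw [clp_hi (by linarith)]
      exact div_nonpos_of_nonpos_of_nonneg (by linarith) hε.le) t ⟨ht, le_rfl⟩
  have l := sgn_le (y := fun t => -2 - x t) (a := a) (b := t) (K := 0)
    (fun s _ => (hx s).const_sub _) (by linarith) (by
      intro s _ hpos
      have h3 := (abs_le.1 (F.lam_abs s)).1
      rw [zero_mul, neg_nonpos]
      unfold Fc
      rw [clp_lo (by linarith)]
      exact div_nonneg (by linarith) hε.le) t ⟨ht, le_rfl⟩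
  exact abs_le.2 ⟨by linarith, by linarith⟩

lemma Frc.cl_sol {k T0 ρ : ℝ} {lam lam' : ℝ → ℝ} (F : Frc k T0 ρ lam lam')
    {ε a b : ℝ} (hε : 0 < ε) {x : ℝ → ℝ}
    (hx : ∀ t, HasDerivAt x (Fc ε lam t (x t)) t) (h0 : |x a| ≤ 2) : IsSol ε lam x a b := by
  intro t ht
  have := hx t
  unfold Fc at this
  rwa [clp_of (F.cl_stays hε hx h0 t ht.1)] at this

/-- Existence of the antiperiodic solution. -/
lemma Frc.exists_anti {k T0 ρ : ℝ} {lam lam' : ℝ → ℝ} (F : Frc k T0 ρ lam lam')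
    {ε q : ℝ} (P : Par ε ρ q) (ha : ∀ t, lam (t + 1 / 2) = -lam t) :
    ∃ x : ℝ → ℝ, (∀ t, HasDerivAt x ((x t - x t ^ 3 + lam t) / ε) t) ∧
      (∀ t, x (t + 1 / 2) = -x t) ∧ ∀ t, |x t| ≤ 2 := by
  have hε := P.ε_pos
  choose X hX0 hX using fun x₀ => F.exists_cl hε T0 x₀
  have hmaps : MapsTo (fun x₀ => -X x₀ (T0 + 1 / 2)) (Icc (-2) 2) (Icc (-2) 2) := by
    intro x₀ h
    have := F.cl_stays hε (hX x₀) (by rw [hX0]; exact abs_le.2 h) (T0 + 1 / 2) (by linarith)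
    rw [← abs_neg] at this
    exact abs_le.1 this
  have hcont : ContinuousOn (fun x₀ => -X x₀ (T0 + 1 / 2)) (Icc (-2) 2) := by
    apply LipschitzOnWith.continuousOn (K := 1)
    refine LipschitzOnWith.of_dist_le_mul fun a ha b hb => ?_
    have hsa := F.cl_sol (b := T0 + 1 / 2) hε (hX a) (by rw [hX0]; exact abs_le.2 ha)
    have hsb := F.cl_sol (b := T0 + 1 / 2) hε (hX b) (by rw [hX0]; exact abs_le.2 hb)
    have := F.contr P hsa hsb
    rw [hX0, hX0] at this
    have h1 : exp (-(1 / (2 * ε))) ≤ 1 := exp_le_one_iff.2 (by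
      have : 0 < 1 / (2 * ε) := by positivity
      linarith)
    have h2 : (X a (T0 + 1 / 2) - X b (T0 + 1 / 2)) ^ 2 ≤ (a - b) ^ 2 := by
      nlinarith [sq_nonneg (a - b)]
    have h3 := sq_le_sq.1 h2
    rw [Real.dist_eq, Real.dist_eq]
    rw [NNReal.coe_one, one_mul, neg_sub_neg, abs_sub_comm]
    exact h3
  obtain ⟨c, hc, hfix⟩ := exists_mem_Icc_isFixedPt_of_mapsTo hcont (by norm_num) hmaps
  have hfix' : -X c (T0 + 1 / 2) = c := hfix
  have hz : ∀ t, HasDerivAt (fun t => -X c (t + 1 / 2)) (Fc ε lam t (-X c (t + 1 / 2))) t := by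
    intro t
    have h := ((hX c (t + 1 / 2)).comp_add_const t (1 / 2)).neg
    refine h.congr_deriv ?_
    unfold Fc
    rw [clp_neg, ha]
    ring
  have heq : (fun t => -X c (t + 1 / 2)) = X c := by
    refine ODE_solution_unique_univ (v := Fc ε lam) (s := fun _ => univ) (t₀ := T0)
      (K := (13 / ε).toNNReal) (fun t => (Fc_lip hε lam t).lipschitzOnWith)
      (fun t => ⟨hz t, trivial⟩) (fun t => ⟨hX c t, trivial⟩) ?_
    show -X c (T0 + 1 / 2) = X c T0
    rw [hfix', hX0]
  have hap : ∀ t, X c (t + 1 / 2) = -X c t := fun t => by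
    have : -X c (t + 1 / 2) = X c t := congrFun heq t
    linarith
  have hn : ∀ n : ℕ, ∀ t, |X c (t + n / 2)| = |X c t| := by
    intro n
    induction n with
    | zero => intro t; simp
    | succ n ih =>
      intro t
      have : t + ((n + 1 : ℕ) : ℝ) / 2 = (t + n / 2) + 1 / 2 := by push_cast; ring
      rw [this, hap, abs_neg, ih]
  have hb : ∀ t, |X c t| ≤ 2 := by
    intro t
    obtain ⟨n, hn'⟩ := exists_nat_ge (2 * (T0 - t))
    rw [← hn n t]
    exact F.cl_stays hε (hX c) (by rw [hX0]; exact abs_le.2 hc) _ (by linarith)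
  refine ⟨X c, fun t => ?_, hap, hb⟩
  have := hX c t
  unfold Fc at this
  rwa [clp_of (hb t)] at this

/-- Attraction. -/
lemma Frc.iter_contr {k T0 ρ : ℝ} {lam lam' : ℝ → ℝ} (F : Frc k T0 ρ lam lam')
    {ε q : ℝ} (P : Par ε ρ q) (ha : ∀ t, lam (t + 1 / 2) = -lam t) (n : ℕ) :
    ∀ x y : ℝ → ℝ, (∀ t, HasDerivAt x ((x t - x t ^ 3 + lam t) / ε) t) →
      (∀ t, HasDerivAt y ((y t - y t ^ 3 + lam t) / ε) t) →
      (x (T0 + n / 2) - y (T0 + n / 2)) ^ 2 ≤ (x T0 - y T0) ^ 2 * exp (-(1 / (2 * ε))) ^ n := by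
  induction n with
  | zero => intro x y _ _; simp
  | succ n ih =>
    intro x y hx hy
    have fl : ∀ z : ℝ → ℝ, (∀ t, HasDerivAt z ((z t - z t ^ 3 + lam t) / ε) t) →
        ∀ t, HasDerivAt (fun t => -z (t + 1 / 2))
          ((-z (t + 1 / 2) - (-z (t + 1 / 2)) ^ 3 + lam t) / ε) t := by
      intro z hz t
      have h := ((hz (t + 1 / 2)).comp_add_const t (1 / 2)).neg
      refine h.congr_deriv ?_
      rw [ha]
      ring
    have h1 := ih _ _ (fl x hx) (fl y hy)
    have h2 := F.contr P (fun t _ => hx t) (fun t _ => hy t)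
    have e : T0 + ((n + 1 : ℕ) : ℝ) / 2 = T0 + n / 2 + 1 / 2 := by push_cast; ring
    rw [e]
    have h3 : 0 ≤ exp (-(1 / (2 * ε))) ^ n := by positivity
    have h4 := mul_le_mul_of_nonneg_right h2 h3
    rw [neg_sub_neg, neg_sub_neg] at h1
    calc _ = (y (T0 + n / 2 + 1 / 2) - x (T0 + n / 2 + 1 / 2)) ^ 2 := by ring
      _ ≤ _ := h1
      _ = (x (T0 + 1 / 2) - y (T0 + 1 / 2)) ^ 2 * exp (-(1 / (2 * ε))) ^ n := by ring
      _ ≤ _ := h4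
      _ = _ := by ring

lemma Frc.attract {k T0 ρ : ℝ} {lam lam' : ℝ → ℝ} (F : Frc k T0 ρ lam lam')
    {ε q : ℝ} (P : Par ε ρ q) (ha : ∀ t, lam (t + 1 / 2) = -lam t)
    {x y : ℝ → ℝ} (hx : ∀ t, HasDerivAt x ((x t - x t ^ 3 + lam t) / ε) t)
    (hy : ∀ t, HasDerivAt y ((y t - y t ^ 3 + lam t) / ε) t) :
    Filter.Tendsto (fun t => |x t - y t|) Filter.atTop (nhds 0) := by
  have hε := P.ε_pos
  have hκ : exp (-(1 / (2 * ε))) < 1 := exp_lt_one_iff.2 (by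
    have : 0 < 1 / (2 * ε) := by positivity
    linarith)
  have hn : Filter.Tendsto (fun t : ℝ => ⌊2 * (t - T0)⌋₊) Filter.atTop Filter.atTop := by
    refine tendsto_nat_floor_atTop.comp ?_
    refine Filter.Tendsto.const_mul_atTop (by norm_num) ?_
    exact Filter.tendsto_atTop_add_const_right _ _ Filter.tendsto_id
  have hlim : Filter.Tendsto (fun t : ℝ => (x T0 - y T0) ^ 2 *
      exp (-(1 / (2 * ε))) ^ ⌊2 * (t - T0)⌋₊ * exp (1 / ε)) Filter.atTop (nhds 0) := by
    have h1 := (tendsto_pow_atTop_nhds_zero_of_lt_one (exp_pos _).le hκ).comp hn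
    have h2 := (h1.const_mul ((x T0 - y T0) ^ 2)).mul_const (exp (1 / ε))
    simpa using h2
  have hD : Filter.Tendsto (fun t => (x t - y t) ^ 2) Filter.atTop (nhds 0) := by
    refine squeeze_zero' (Filter.Eventually.of_forall fun t => sq_nonneg _) ?_ hlim
    filter_upwards [Filter.eventually_ge_atTop T0] with t ht
    set n := ⌊2 * (t - T0)⌋₊ with hndef
    have h1 : (n : ℝ) ≤ 2 * (t - T0) := Nat.floor_le (by linarith)
    have h2 : 2 * (t - T0) < n + 1 := Nat.lt_floor_add_one _
    have h3 := F.iter_contr P ha n x y hx hy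
    have h4 := dist_growth (a := T0 + n / 2) (b := t) hε (by linarith) (fun t _ => hx t)
      (fun t _ => hy t)
    refine h4.trans (mul_le_mul h3 ?_ (exp_pos _).le (by positivity))
    apply exp_le_exp.2
    rw [div_mul_eq_mul_div]
    exact div_le_div_of_nonneg_right (by linarith) hε.le
  have := (Real.continuous_sqrt.tendsto 0).comp hD
  simpa [Function.comp_def, Real.sqrt_sq_eq_abs] using this

/-- the antiperiodic solution starts in the right well -/
lemma Frc.start {k T0 ρ : ℝ} {lam lam' : ℝ → ℝ} (F : Frc k T0 ρ lam lam')
    {ε q : ℝ} (P : Par ε ρ q) {x : ℝ → ℝ}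
    (hx : IsSol ε lam x T0 (T0 + 1 / 2)) (hper : x (T0 + 1 / 2) = -x T0) : k ≤ x T0 := by
  have hs := P.s_pos
  have hss := P.s_small
  have jx := F.jump P (hx.mono le_rfl (by linarith))
  have hk2 := F.khi
  have := F.upper_negk (a := T0 + 25 * (ε / q)) (b := T0 + 1 / 2) P.ε_pos
    (hx.mono (by linarith) le_rfl) (by linarith) le_rfl (by linarith) (T0 + 1 / 2)
    ⟨by linarith, le_rfl⟩
  linarith

lemma Frc.signs {k T0 ρ : ℝ} {lam lam' : ℝ → ℝ} (F : Frc k T0 ρ lam lam')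
    {ε q : ℝ} (P : Par ε ρ q) {x : ℝ → ℝ}
    (hx : IsSol ε lam x T0 (T0 + 1 / 2)) (h0 : k ≤ x T0) :
    ∃ σ, T0 < σ ∧ σ < T0 + 1 / 2 ∧ (∀ t, T0 ≤ t → t < σ → 0 < x t) ∧
      ∀ t, σ < t → t ≤ T0 + 1 / 2 → x t < 0 := by
  have hε := P.ε_pos
  have hs := P.s_pos
  have hss := P.s_small
  have hsl := P.s_le
  have hT := F.T0rho
  have hr := F.rpos
  have hk := F.klo
  have hk2 := F.khi
  have hT4 := F.T0lo
  have jx := F.jump P (hx.mono le_rfl (by linarith))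
  set Tm := T0 + 25 * (ε / q) with hTm
  have hTm1 : T0 ≤ Tm := by linarith
  have hTm0 : Tm ≤ 0 := by linarith
  have nk := F.upper_negk (a := Tm) (b := T0 + 1 / 2) P.ε_pos
    (hx.mono (by linarith) le_rfl) (by linarith) le_rfl (by linarith)
  have hanti := F.x_anti hε (hx.mono le_rfl (by linarith)) (by linarith)
  have hc : ContinuousOn x (Icc T0 Tm) := fun t ht =>
    (hx t ⟨ht.1, by linarith [ht.2]⟩).continuousAt.continuousWithinAt
  obtain ⟨σ, hσ⟩ : ∃ σ, IsLeast (Icc T0 Tm ∩ x ⁻¹' (Iic 0)) σ := by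
    refine IsCompact.exists_isLeast ?_ ?_
    · exact isCompact_Icc.of_isClosed_subset (hc.preimage_isClosed_of_isClosed isClosed_Icc isClosed_Iic)
        inter_subset_left
    · exact ⟨Tm, ⟨hTm1, le_rfl⟩, by show x Tm ≤ 0; linarith⟩
  obtain ⟨⟨⟨hσ0, hσ1⟩, hσx⟩, hσl⟩ := hσ
  have hσx' : x σ ≤ 0 := hσx
  have hσT : T0 < σ := by
    rcases hσ0.lt_or_eq with h | h
    · exact h
    · rw [← h] at hσx'; linarith
  refine ⟨σ, hσT, by linarith, ?_, ?_⟩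
  · intro t ht htσ
    by_contra hcon
    push Not at hcon
    have := hσl ⟨⟨ht, by linarith⟩, hcon⟩
    linarith
  · intro t ht htc
    rcases le_or_gt t Tm with h | h
    · have h1 := hanti σ t hσ0 ht.le (by linarith)
      by_contra hcon
      push Not at hcon
      have hz : ∀ r ∈ Icc σ t, x r = 0 := by
        intro r hr
        have h2 := hanti σ r hσ0 hr.1 (by linarith [hr.2])
        have h3 := hanti r t (by linarith [hr.1]) hr.2 (by linarith)
        linarith
      have := incr_le (f := x) (g := fun s => -(2 * k / 3) / ε * s)
        (g' := fun s => -(2 * k / 3) / ε * 1) ht.le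
        (hx.mono hσ0 (by linarith)) (fun s _ => (hasDerivAt_id s).const_mul _)
        (fun r hr => by
          have h4 := F.lam_hi1 r ⟨by linarith [hr.1], by linarith [hr.2]⟩
          rw [hz r ⟨hr.1.le, hr.2.le⟩, mul_one]
          exact div_le_div_of_nonneg_right (by linarith) hε.le)
      have h5 : -(2 * k / 3) / ε < 0 := div_neg_of_neg_of_pos (by linarith) hε
      rw [hz t ⟨ht.le, le_rfl⟩, hz σ ⟨le_rfl, ht.le⟩] at this
      nlinarith
    · have := nk t ⟨h.le, htc⟩
      linarith

/-- Everything for an abstract forcing. -/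
lemma Frc.main {k T0 ρ : ℝ} {lam lam' : ℝ → ℝ} (F : Frc k T0 ρ lam lam')
    {ε q : ℝ} (P : Par ε ρ q) (ha : ∀ t, lam (t + 1 / 2) = -lam t)
    (ha' : ∀ t, lam' (t + 1 / 2) = -lam' t) (hc' : Continuous lam') :
    ∃ x : ℝ → ℝ, (∀ t, HasDerivAt x ((x t - x t ^ 3 + lam t) / ε) t) ∧
      (∀ t, x (t + 1) = x t) ∧
      (∃ s₁ s₂ : ℝ, s₁ < s₂ ∧ s₂ < s₁ + 1 ∧
            (∀ t ∈ Ioo s₁ s₂, 0 < x t) ∧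
            (∀ t ∈ Ioo s₂ (s₁ + 1), x t < 0)) ∧
      (∀ y : ℝ → ℝ, (∀ t, HasDerivAt y ((y t - y t ^ 3 + lam t) / ε) t) →
            Filter.Tendsto (fun t => |y t - x t|) Filter.atTop (nhds 0)) ∧
      q ^ 2 / 4 ≤ (-∫ t in (0:ℝ)..1, x t * lam' t) - 3 / 2 ∧
      (-∫ t in (0:ℝ)..1, x t * lam' t) - 3 / 2 ≤ 400 * q ^ 2 := by
  obtain ⟨x, hx, hap, hb⟩ := F.exists_anti P ha
  have hsol : IsSol ε lam x T0 (T0 + 1 / 2) := fun t _ => hx t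
  have h0 := F.start P hsol (hap T0)
  have hxc : Continuous x := continuous_iff_continuousAt.2 fun t => (hx t).continuousAt
  have hg : Continuous fun t => x t * lam' t := hxc.mul hc'
  have hJ : ∀ t, HasDerivAt (fun t => ∫ r in T0..t, x r * lam' r) (x t * lam' t) t := fun t =>
    intervalIntegral.integral_hasDerivAt_right (hg.intervalIntegrable _ _)
      hg.aestronglyMeasurable.stronglyMeasurableAtFilter hg.continuousAt
  have hlow := F.area_lower P hsol (fun t _ => hJ t) h0 (hap T0)
  have hupp := F.area_upper P hsol (fun t _ => hJ t) h0 (abs_le.1 (hb T0)).2 (hap T0)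
  have hp1 : ∀ t, x (t + 1) = x t := fun t => by
    have : t + 1 = t + 1 / 2 + 1 / 2 := by ring
    rw [this, hap, hap, neg_neg]
  have hper : Function.Periodic (fun t => x t * lam' t) (1 / 2) := fun t => by
    simp only
    rw [hap, ha']; ring
  have hInt : ∫ t in (0:ℝ)..1, x t * lam' t = 2 * ∫ t in T0..(T0 + 1 / 2), x t * lam' t := by
    have h1 := intervalIntegral.integral_add_adjacent_intervals
      (hg.intervalIntegrable (μ := volume) 0 (1 / 2)) (hg.intervalIntegrable (1 / 2) 1)
    have h2 := hper.intervalIntegral_add_eq 0 T0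
    have h3 := hper.intervalIntegral_add_eq (1 / 2) T0
    rw [zero_add] at h2
    norm_num at h3 h2 h1 ⊢
    linarith
  have hT : ∫ t in T0..T0, x t * lam' t = 0 := intervalIntegral.integral_same
  simp only [hT, sub_zero] at hlow hupp
  refine ⟨x, hx, hp1, ?_, fun y hy => F.attract P ha hy hx, ?_, ?_⟩
  · obtain ⟨σ, h1, h2, hpos, hneg⟩ := F.signs P hsol h0
    refine ⟨σ - 1 / 2, σ, by linarith, by linarith, ?_, ?_⟩
    · intro t ht
      rcases le_or_gt t T0 with h | h
      · have h3 := hneg (t + 1 / 2) (by linarith [ht.1]) (by linarith)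
        rw [hap] at h3
        linarith
      · exact hpos t h.le ht.2
    · intro t ht
      rcases le_or_gt t (T0 + 1 / 2) with h | h
      · exact hneg t ht.1 h
      · have h3 := hpos (t - 1 / 2) (by linarith) (by linarith [ht.2])
        have h4 := hap (t - 1 / 2)
        rw [sub_add_cancel] at h4
        linarith
  · rw [hInt]; linarith
  · rw [hInt]; linarith


end Hyst


namespace Hyst

lemma sin_sub_le {a b : ℝ} (h : a ≤ b) : sin b - sin a ≤ b - a := by
  have := incr_le (f := sin) (g := fun t => t) (f' := cos) (g' := fun _ => 1) h
    (fun t _ => Real.hasDerivAt_sin t) (fun t _ => hasDerivAt_id t) (fun t _ => cos_le_one t)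
  exact this

set_option maxHeartbeats 2000000 in
/-- The cosine forcing satisfies the abstract assumptions. -/
lemma frc_cos {k A : ℝ} (hk0 : 0 < k) (hk : 3 * k ^ 2 = 1) (hA1 : 2 * k / 3 < A)
    (hA2 : A ≤ 2 * (2 * k / 3)) :
    ∃ T0 ρ, Frc k T0 ρ (fun t => -(A * cos (2 * π * t))) (fun t => 2 * π * A * sin (2 * π * t)) ∧
      ρ ^ 2 = 4 * π ^ 2 * (A ^ 2 - (2 * k / 3) ^ 2) := by
  have klo : 0.577 < k := by nlinarith
  have khi : k < 0.578 := by nlinarith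
  have hA0 : 0 < A := by linarith
  have hA3 : A ≤ 0.771 := by linarith
  have hπ := pi_pos
  have hπ2 := pi_lt_d2
  have hπ3 := pi_gt_three
  have hpp : π ^ 2 ≤ 9.93 := by nlinarith
  have hpA : 4 * π ^ 2 * A ≤ 31 := by nlinarith
  obtain ⟨θ, hθ⟩ : ∃ θ, θ = arccos (2 * k / 3 / A) := ⟨_, rfl⟩
  have hr1 : 2 * k / 3 / A < 1 := (div_lt_one hA0).2 hA1
  have hr0 : 0 < 2 * k / 3 / A := by positivity
  have hθ1 : θ < π / 2 := by rw [hθ]; exact arccos_lt_pi_div_two.2 hr0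
  have hθ0 : 0 < θ := by rw [hθ]; exact arccos_pos.2 hr1
  have hcos : A * cos θ = 2 * k / 3 := by
    rw [hθ, cos_arccos (by linarith) hr1.le]; field_simp
  have hsin : 0 < sin θ := sin_pos_of_pos_of_lt_pi hθ0 (by linarith)
  have hT : 2 * π * (-θ / (2 * π)) = -θ := by field_simp
  have hT' : 2 * π * (-θ / (2 * π) + 1 / 2) = π - θ := by field_simp; ring
  obtain ⟨T0, hT0⟩ : ∃ T0, T0 = -θ / (2 * π) := ⟨_, rfl⟩
  rw [← hT0] at hT hT'
  have mono : ∀ {a b : ℝ}, a ≤ b → 2 * π * a ≤ 2 * π * b := fun h =>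
    mul_le_mul_of_nonneg_left h (by positivity)
  have hlamle : ∀ t ∈ Icc T0 (T0 + 1 / 2), -(A * cos (2 * π * t)) ≤ 2 * k / 3 := by
    intro t ht
    have h1 := mono ht.1
    have h2 := mono ht.2
    rw [hT] at h1
    rw [hT'] at h2
    have h3 : cos (π - θ) ≤ cos |2 * π * t| :=
      cos_le_cos_of_nonneg_of_le_pi (abs_nonneg _) (by linarith) (abs_le.2 ⟨by linarith, h2⟩)
    rw [cos_abs, cos_pi_sub] at h3
    have := mul_le_mul_of_nonneg_left h3 hA0.le
    linarith
  refine ⟨T0, 2 * π * A * sin θ, ?_, ?_⟩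
  · refine
      { k3 := hk, klo := klo, khi := khi, T0lo := ?_, rpos := by positivity, rle := ?_, der := ?_,
        lamT0 := ?_, lamtc := ?_, lam_le := hlamle, lam_neg := ?_, lam_abs := ?_, der_lo := ?_,
        der_neg := ?_, der_hi := ?_, T0rho := ?_, der_pos := ?_, der_sq := ?_ }
    · nlinarith
    · have h1 := sin_le_one θ
      have h2 : 2 * π * A ≤ 5 := by nlinarith
      have h3 : 2 * π * A * sin θ ≤ 2 * π * A * 1 := mul_le_mul_of_nonneg_left h1 (by positivity)
      linarith
    · intro t
      have h := ((((hasDerivAt_id t).const_mul (2 * π)).cos).const_mul A).neg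
      refine h.congr_deriv ?_
      simp only [id]
      ring
    · simp only [hT, cos_neg]; rw [hcos]
    · simp only [hT', cos_pi_sub]; linarith
    · intro t ht
      have h1 := mono ht.1
      have h2 := mono ht.2
      rw [hT] at h1
      have := cos_nonneg_of_neg_pi_div_two_le_of_le (x := 2 * π * t) (by linarith) (by linarith)
      have := mul_nonneg hA0.le this
      linarith
    · intro t
      rw [abs_neg, abs_mul, abs_of_pos hA0]
      have := abs_cos_le_one (2 * π * t)
      nlinarith [abs_nonneg (cos (2 * π * t))]
    · intro t ht
      have h1 := mono ht.1
      have h2 := mono ht.2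
      rw [hT] at h1
      have := sin_le_sin_of_le_of_le_pi_div_two (x := -θ) (y := 2 * π * t) (by linarith)
        (by linarith) h1
      rw [sin_neg] at this
      have := mul_le_mul_of_nonneg_left this (by positivity : 0 ≤ 2 * π * A)
      linarith
    · intro t ht
      have h1 := mono ht.1
      have h2 := mono ht.2
      rw [hT] at h1
      have := sin_nonpos_of_nonpos_of_neg_pi_le (x := 2 * π * t) (by linarith) (by linarith)
      exact mul_nonpos_of_nonneg_of_nonpos (by positivity) this
    · intro t ht
      have h1 := mono ht.1
      rw [hT] at h1
      have h3 := sin_sub_le h1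
      rw [sin_neg, ← hT] at h3
      have h4 := mul_le_mul_of_nonneg_left h3 (by positivity : 0 ≤ 2 * π * A)
      have h5 := mul_le_mul_of_nonneg_right hpA (by linarith [ht.1] : 0 ≤ t - T0)
      linarith
    · have h1 := sin_le hθ0.le
      have h2 : θ = -(2 * π * T0) := by linarith
      have h3 := mul_le_mul_of_nonneg_left h1 (by positivity : 0 ≤ 2 * π * A)
      have hTn : T0 ≤ 0 := by nlinarith
      have h5 := mul_le_mul_of_nonneg_right hpA (by linarith : 0 ≤ -T0)
      have h6 : 2 * π * A * θ = 4 * π ^ 2 * A * -T0 := by rw [h2]; ring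
      linarith
    · intro t ht
      have h1 := mono ht.1
      have h2 := mono ht.2
      rw [hT'] at h2
      have := sin_nonneg_of_nonneg_of_le_pi (x := 2 * π * t) (by linarith) (by linarith)
      exact mul_nonneg (by positivity) this
    · intro t ht
      have hTn : T0 ≤ 0 := by nlinarith
      have h1 := hlamle t ⟨by linarith [ht.1], ht.2⟩
      have e1 : (2 * π * A * sin θ) ^ 2 = 4 * π ^ 2 * (A ^ 2 - (2 * k / 3) ^ 2) := by
        rw [← hcos]
        have := sin_sq_add_cos_sq θ
        linear_combination 4 * π ^ 2 * A ^ 2 * this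
      rw [e1]
      obtain ⟨l, hl⟩ : ∃ l, l = -(A * cos (2 * π * t)) := ⟨_, rfl⟩
      rw [← hl] at h1 ⊢
      have e2 : (2 * π * A * sin (2 * π * t)) ^ 2 = 4 * π ^ 2 * (A ^ 2 - l ^ 2) := by
        rw [hl]
        have := sin_sq_add_cos_sq (2 * π * t)
        linear_combination 4 * π ^ 2 * A ^ 2 * this
      rw [e2]
      have h2 : 4 * π ^ 2 * (2 * k / 3 + l) ≤ 31 := by nlinarith
      have h3 := mul_le_mul_of_nonneg_right h2 (by linarith : 0 ≤ 2 * k / 3 - l)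
      linarith
  · rw [← hcos]
    have := sin_sq_add_cos_sq θ
    linear_combination 4 * π ^ 2 * A ^ 2 * this

lemma k_eq : 2 / (3 * √3) = 2 * (1 / √3) / 3 := by
  have : 0 < √3 := by positivity
  field_simp

set_option maxHeartbeats 1000000 in
/-- parameters -/
lemma par_ex {k A ε ρ : ℝ} (hk0 : 0 < k) (hk : 3 * k ^ 2 = 1) (hε : 0 < ε) (hε2 : ε ≤ 1 / 10 ^ 7)
    (hA1 : 2 * k / 3 + 10 ^ 6 * ε ≤ A) (hA2 : A ≤ 2 * (2 * k / 3)) (hr : 0 < ρ) (hr5 : ρ ≤ 5)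
    (hρ : ρ ^ 2 = 4 * π ^ 2 * (A ^ 2 - (2 * k / 3) ^ 2)) :
    ∃ q, Par ε ρ q ∧ ε ^ ((2:ℝ)/3) * (A - 2 * k / 3) ^ ((1:ℝ)/3) ≤ q ^ 2 ∧
      q ^ 2 ≤ 4 * (ε ^ ((2:ℝ)/3) * (A - 2 * k / 3) ^ ((1:ℝ)/3)) := by
  have klo : 0.577 < k := by nlinarith
  have khi : k < 0.578 := by nlinarith
  have hπ2 := pi_lt_d2
  have hπ3 := pi_gt_three
  have hpp : π ^ 2 ≤ 9.93 := by nlinarith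
  have hpp2 : 9 ≤ π ^ 2 := by nlinarith
  have hB : 0 < A - 2 * k / 3 := by linarith
  obtain ⟨q, hq⟩ : ∃ q, q = (ε * ρ) ^ ((1:ℝ)/3) := ⟨_, rfl⟩
  obtain ⟨g, hg⟩ : ∃ g, g = ε ^ ((2:ℝ)/3) * (A - 2 * k / 3) ^ ((1:ℝ)/3) := ⟨_, rfl⟩
  have hq0 : 0 < q := by rw [hq]; positivity
  have hg0 : 0 < g := by rw [hg]; positivity
  have hq3 : q ^ 3 = ε * ρ := by
    rw [hq, ← rpow_natCast, ← rpow_mul (by positivity)]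
    norm_num
  have hg3 : g ^ 3 = ε ^ 2 * (A - 2 * k / 3) := by
    rw [hg, mul_pow, ← rpow_natCast, ← rpow_mul (by positivity), ← rpow_natCast, ← rpow_mul hB.le]
    norm_num
  have hq6 : (q ^ 2) ^ 3 = 4 * π ^ 2 * (A + 2 * k / 3) * g ^ 3 := by
    calc (q ^ 2) ^ 3 = (q ^ 3) ^ 2 := by ring
      _ = ε ^ 2 * ρ ^ 2 := by rw [hq3]; ring
      _ = _ := by rw [hρ, hg3]; ring
  have hC1 : 1 ≤ 4 * π ^ 2 * (A + 2 * k / 3) := by nlinarith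
  have hC2 : 4 * π ^ 2 * (A + 2 * k / 3) ≤ 64 := by nlinarith
  have hg30 : 0 < g ^ 3 := by positivity
  have l1 : g ≤ q ^ 2 := by
    rw [← pow_le_pow_iff_left₀ hg0.le (by positivity) three_ne_zero, hq6]
    have := mul_le_mul_of_nonneg_right hC1 hg30.le
    linarith
  have l2 : q ^ 2 ≤ 4 * g := by
    rw [← pow_le_pow_iff_left₀ (by positivity) (by positivity) three_ne_zero, hq6]
    have := mul_le_mul_of_nonneg_right hC2 hg30.le
    rw [mul_pow]
    linarith
  have l3 : 100 * ε ≤ g := by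
    rw [← pow_le_pow_iff_left₀ (by positivity) (by positivity) three_ne_zero, hg3]
    have : ε ^ 2 * (10 ^ 6 * ε) ≤ ε ^ 2 * (A - 2 * k / 3) :=
      mul_le_mul_of_nonneg_left (by linarith) (by positivity)
    linarith
  have l4 : q ≤ 1 / 100 := by
    rw [← pow_le_pow_iff_left₀ (by positivity) (by positivity) three_ne_zero, hq3]
    have : ε * ρ ≤ 1 / 10 ^ 7 * 5 := mul_le_mul hε2 hr5 hr.le (by positivity)
    norm_num at this ⊢
    linarith
  rw [← hg]
  exact ⟨q, ⟨hε, hq0, hq3, l3.trans l1, l4⟩, l1, l2⟩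

end Hyst

/-- deterministic large-amplitude hysteresis, scaling law
`𝒜 - 𝒜₀ ≍ ε^{2/3}(A - λ_c)^{1/3}`. For `λ_c + γ₁ε ≤ A ≤ 2λ_c`, the equation
`εẋ = x - x³ - A cos(2πt)` admits a periodic solution `x̂` of period 1 which changes sign
twice per period (positive on one arc of the period, negative on the complementary arc)
and attracts all solutions; its hysteresis area `𝒜 = -∫₀¹ x̂_t λ'(t) dt` satisfies
`c₋ε^{2/3}(A-λ_c)^{1/3} ≤ 𝒜 - 𝒜₀ ≤ c₊ε^{2/3}(A-λ_c)^{1/3}` with `𝒜₀ = 3/2`. -/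
theorem statement_17 :
    ∃ γ₁ > (0:ℝ), ∃ ε₀ > (0:ℝ), ∃ cm > (0:ℝ), ∃ cp > cm,
      ∀ ε A : ℝ, 0 < ε → ε ≤ ε₀ →
        2 / (3 * Real.sqrt 3) + γ₁ * ε ≤ A → A ≤ 2 * (2 / (3 * Real.sqrt 3)) →
        ∃ xhat : ℝ → ℝ,
          -- `x̂` solves `εẋ = x - x³ - A cos(2πt)` and has period 1
          (∀ t, HasDerivAt xhat ((xhat t - xhat t ^ 3 - A * Real.cos (2 * π * t)) / ε) t) ∧
          (∀ t, xhat (t + 1) = xhat t) ∧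
          -- `x̂` changes sign twice per period
          (∃ s₁ s₂ : ℝ, s₁ < s₂ ∧ s₂ < s₁ + 1 ∧
            (∀ t ∈ Ioo s₁ s₂, 0 < xhat t) ∧
            (∀ t ∈ Ioo s₂ (s₁ + 1), xhat t < 0)) ∧
          -- `x̂` attracts all solutions
          (∀ x : ℝ → ℝ,
            (∀ t, HasDerivAt x ((x t - x t ^ 3 - A * Real.cos (2 * π * t)) / ε) t) →
            Filter.Tendsto (fun t => |x t - xhat t|) Filter.atTop (nhds 0)) ∧
          -- scaling law for the hysteresis area (`λ'(t) = 2πA sin(2πt)`, `𝒜₀ = 3/2`)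
          cm * ε ^ ((2:ℝ)/3) * (A - 2 / (3 * Real.sqrt 3)) ^ ((1:ℝ)/3) ≤
            (-∫ t in (0:ℝ)..1, xhat t * (2 * π * A * Real.sin (2 * π * t))) - 3 / 2 ∧
          (-∫ t in (0:ℝ)..1, xhat t * (2 * π * A * Real.sin (2 * π * t))) - 3 / 2 ≤
            cp * ε ^ ((2:ℝ)/3) * (A - 2 / (3 * Real.sqrt 3)) ^ ((1:ℝ)/3) := by
  refine ⟨10 ^ 6, by norm_num, 1 / 10 ^ 7, by norm_num, 1 / 4, by norm_num, 2000, by norm_num, ?_⟩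
  intro ε A hε hε2 hA1 hA2
  rw [Hyst.k_eq] at hA1 hA2 ⊢
  obtain ⟨k, hkdef⟩ : ∃ k, k = 1 / √3 := ⟨_, rfl⟩
  rw [← hkdef] at hA1 hA2 ⊢
  have hk0 : 0 < k := by rw [hkdef]; positivity
  have hk : 3 * k ^ 2 = 1 := by
    rw [hkdef, div_pow, Real.sq_sqrt (by norm_num)]; norm_num
  obtain ⟨T0, ρ, F, hρ⟩ := Hyst.frc_cos hk0 hk (A := A) (by nlinarith) hA2
  obtain ⟨q, P, l1, l2⟩ := Hyst.par_ex hk0 hk hε hε2 hA1 hA2 F.rpos F.rle hρ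
  have harg : ∀ t : ℝ, 2 * π * (t + 1 / 2) = 2 * π * t + π := fun t => by ring
  obtain ⟨x, h1, h2, h3, h4, h5, h6⟩ := F.main P
    (fun t => by simp only [harg, cos_add_pi]; ring)
    (fun t => by simp only [harg, sin_add_pi]; ring) (by fun_prop)
  refine ⟨x, ?_, h2, h3, ?_, ?_, ?_⟩
  · intro t
    have := h1 t
    rwa [← sub_eq_add_neg] at this
  · intro y hy
    refine h4 y fun t => ?_
    rw [← sub_eq_add_neg]
    exact hy t
  · rw [mul_assoc (1 / 4 : ℝ)]
    linarith
  · rw [mul_assoc (2000 : ℝ)]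
    have : 0 < q ^ 2 := pow_pos P.q_pos 2
    linarith
end

section
/- Let a₀ > 0, let a* : ℝ → ℝ be a bounded C² function with bounded derivatives and a*(t) ≤ −a₀ for all t, and let x* : ℝ → ℝ be a bounded C² function with bounded derivatives. Set α*(t) = ∫₀ᵗ a*(u) du. Then there exist ε₀ > 0 and C > 0 such that for each ε ∈ (0,ε₀] the equation ε ẋ = a*(t)(x − x*(t)) admits a particular (adiabatic) solution x̄ satisfying | x̄_t − x*(t) − ε ẋ*(t)/a*(t) | ≤ C ε² for all t ≥ 0; moreover, every solution x with initial condition x_0 satisfies x_t = x̄_t + (x_0 − x̄_0) e^{α*(t)/ε} for all t ≥ 0, and hence approaches x̄ exponentially fast since α*(t) ≤ −a₀ t. -/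
open MeasureTheory Real Set

/-- adiabatic solution tracking a moving quadratic well. For
`εẋ = a*(t)(x - x*(t))` with `a*(t) ≤ -a₀ < 0` there is a particular (adiabatic) solution
`x̄` with `x̄_t = x*(t) + εẋ*(t)/a*(t) + O(ε²)`, every solution satisfies
`x_t = x̄_t + (x_0 - x̄_0)e^{α*(t)/ε}`, and `α*(t) ≤ -a₀t`, so every solution approaches
`x̄` exponentially fast. -/
theorem statement_18
    (a₀ Ca Cx : ℝ) (astar xstar : ℝ → ℝ)
    (ha₀ : 0 < a₀)
    -- `a*` is bounded C² with bounded derivatives, `a*(t) ≤ -a₀`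
    (hasm : ContDiff ℝ 2 astar)
    (hastab : ∀ t, astar t ≤ -a₀)
    (habd : ∀ t, |astar t| ≤ Ca ∧ |deriv astar t| ≤ Ca ∧ |deriv (deriv astar) t| ≤ Ca)
    -- `x*` is bounded C² with bounded derivatives
    (hxsm : ContDiff ℝ 2 xstar)
    (hxbd : ∀ t, |xstar t| ≤ Cx ∧ |deriv xstar t| ≤ Cx ∧ |deriv (deriv xstar) t| ≤ Cx) :
    ∃ ε₀ > (0:ℝ), ∃ C > (0:ℝ),
      ∀ ε : ℝ, 0 < ε → ε ≤ ε₀ →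
        ∃ xbar : ℝ → ℝ,
          -- `x̄` is a particular solution of `εẋ = a*(t)(x - x*(t))`
          (∀ t, HasDerivAt xbar (astar t * (xbar t - xstar t) / ε) t) ∧
          -- it tracks the bottom of the well: `x̄_t = x*(t) + εẋ*(t)/a*(t) + O(ε²)`
          (∀ t : ℝ, 0 ≤ t →
            |xbar t - xstar t - ε * deriv xstar t / astar t| ≤ C * ε ^ 2) ∧
          -- every solution is `x̄_t + (x_0 - x̄_0)e^{α*(t)/ε}` …
          (∀ x : ℝ → ℝ,
            (∀ t, HasDerivAt x (astar t * (x t - xstar t) / ε) t) →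
            ∀ t : ℝ, 0 ≤ t →
              x t = xbar t + (x 0 - xbar 0) * Real.exp ((∫ u in (0:ℝ)..t, astar u) / ε)) ∧
          -- … and approaches `x̄` exponentially fast, since `α*(t) ≤ -a₀t`
          (∀ t : ℝ, 0 ≤ t → (∫ u in (0:ℝ)..t, astar u) ≤ -a₀ * t) := by
  have hac : Continuous astar := hasm.continuous
  have hA : ∀ t, HasDerivAt (fun t => ∫ u in (0:ℝ)..t, astar u) (astar t) t := fun t =>
    intervalIntegral.integral_hasDerivAt_right (hac.intervalIntegrable _ _)
      (hac.stronglyMeasurableAtFilter _ _) hac.continuousAt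
  have hA0 : (∫ u in (0:ℝ)..0, astar u) = 0 := intervalIntegral.integral_same
  have hAle : ∀ t : ℝ, 0 ≤ t → (∫ u in (0:ℝ)..t, astar u) ≤ -a₀ * t := by
    intro t ht
    have h := intervalIntegral.integral_mono_on (μ := volume) ht (hac.intervalIntegrable 0 t)
      (continuous_const.intervalIntegrable (μ := volume) (u := fun _ : ℝ => -a₀) 0 t)
      (fun u _ => hastab u)
    rw [intervalIntegral.integral_const] at h
    simp only [smul_eq_mul, sub_zero] at h
    linarith
  generalize hAdef : (fun t => ∫ u in (0:ℝ)..t, astar u) = A at hA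
  have hAe : ∀ t, (∫ u in (0:ℝ)..t, astar u) = A t := fun t => by rw [← hAdef]
  simp only [hAe] at hA0 hAle ⊢
  have hane : ∀ t, astar t ≠ 0 := fun t => by have := hastab t; linarith
  have hx1 : ContDiff ℝ 1 (deriv xstar) := by
    have h : ContDiff ℝ (1 + 1) xstar := by simpa [one_add_one_eq_two] using hxsm
    exact (contDiff_succ_iff_deriv.1 h).2.2
  have ha1 : ContDiff ℝ 1 astar := hasm.of_le (by norm_num)
  have hxd : ∀ t, HasDerivAt xstar (deriv xstar t) t := fun t =>
    ((hxsm.differentiable (by norm_num)) t).hasDerivAt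
  have hg1 : ContDiff ℝ 1 (fun t => deriv xstar t / astar t) := hx1.div ha1 hane
  have hgd0 : ∀ t, HasDerivAt (fun t => deriv xstar t / astar t)
      ((deriv (deriv xstar) t * astar t - deriv xstar t * deriv astar t) / astar t ^ 2) t :=
    fun t => (((hx1.differentiable (by norm_num)) t).hasDerivAt).div
      ((ha1.differentiable (by norm_num)) t).hasDerivAt (hane t)
  obtain ⟨g, hg⟩ : ∃ g : ℝ → ℝ, g = fun t => deriv xstar t / astar t := ⟨_, rfl⟩
  rw [← hg] at hg1 hgd0
  have hgc : Continuous (deriv g) := hg1.continuous_deriv (by norm_num)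
  have hgd : ∀ t, HasDerivAt g (deriv g t) t := fun t => (hgd0 t).differentiableAt.hasDerivAt
  have hCa : 0 ≤ Ca := (abs_nonneg _).trans (habd 0).1
  have hCx : 0 ≤ Cx := (abs_nonneg _).trans (hxbd 0).1
  obtain ⟨K, hK⟩ : ∃ K : ℝ, K = (Cx * Ca + Cx * Ca) / a₀ ^ 2 + 1 := ⟨_, rfl⟩
  have hKpos : 0 < K := by rw [hK]; positivity
  have hgb : ∀ t, |deriv g t| ≤ K := by
    intro t
    rw [(hgd0 t).deriv, abs_div, hK]
    have h1 : |deriv (deriv xstar) t * astar t - deriv xstar t * deriv astar t|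
        ≤ Cx * Ca + Cx * Ca := by
      refine (abs_sub _ _).trans ?_
      rw [abs_mul, abs_mul]
      exact add_le_add
        (mul_le_mul (hxbd t).2.2 (habd t).1 (abs_nonneg _) hCx)
        (mul_le_mul (hxbd t).2.1 (habd t).2.1 (abs_nonneg _) hCx)
    have h2 : a₀ ^ 2 ≤ |astar t ^ 2| := by
      rw [abs_of_nonneg (sq_nonneg _)]
      nlinarith [hastab t]
    have h3 := div_le_div₀ (by positivity) h1 (by positivity) h2
    linarith
  refine ⟨1, one_pos, K / a₀, by positivity, ?_⟩
  intro ε hε _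
  have hEm : ∀ t, HasDerivAt (fun t => rexp (-(A t / ε))) (rexp (-(A t / ε)) * (-(astar t / ε))) t :=
    fun t => (((hA t).div_const ε).neg).exp
  have hE : ∀ t, HasDerivAt (fun t => rexp (A t / ε)) (rexp (A t / ε) * (astar t / ε)) t :=
    fun t => ((hA t).div_const ε).exp
  have hEE : ∀ t, rexp (A t / ε) * rexp (-(A t / ε)) = 1 := fun t => by
    rw [← Real.exp_add]; simp
  have hic : Continuous (fun u => ε * deriv g u * rexp (-(A u / ε))) := by
    have : Continuous (fun t => rexp (-(A t / ε))) :=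
      continuous_iff_continuousAt.2 fun t => (hEm t).continuousAt
    fun_prop
  have hw : ∀ t, HasDerivAt (fun t => ∫ u in (0:ℝ)..t, ε * deriv g u * rexp (-(A u / ε)))
      (ε * deriv g t * rexp (-(A t / ε))) t := fun t =>
    intervalIntegral.integral_hasDerivAt_right (hic.intervalIntegrable _ _)
      (hic.stronglyMeasurableAtFilter _ _) hic.continuousAt
  obtain ⟨w, hwdef⟩ : ∃ w : ℝ → ℝ,
    w = (fun t => ∫ u in (0:ℝ)..t, ε * deriv g u * rexp (-(A u / ε))) := ⟨_, rfl⟩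
  rw [← hwdef] at hw
  have hw0 : w 0 = 0 := by rw [hwdef]; exact intervalIntegral.integral_same
  have hsol : ∀ t, HasDerivAt (fun t => xstar t + ε * g t - rexp (A t / ε) * w t)
      (astar t * ((xstar t + ε * g t - rexp (A t / ε) * w t) - xstar t) / ε) t := by
    intro t
    have h := ((hxd t).add ((hgd t).const_mul ε)).sub ((hE t).mul (hw t))
    refine h.congr_deriv ?_
    have e1 : rexp (A t / ε) * (ε * deriv g t * rexp (-(A t / ε))) = ε * deriv g t := by
      linear_combination (ε * deriv g t) * hEE t
    have e2 : deriv xstar t = astar t * g t := by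
      rw [hg]; field_simp [hane t]
    rw [e1, e2]
    field_simp
    ring
  refine ⟨fun t => xstar t + ε * g t - rexp (A t / ε) * w t, hsol, ?_, ?_, hAle⟩
  · intro t ht
    have key : ∀ s : ℝ, |s| = 1 → s * w t ≤ K / a₀ * ε ^ 2 * rexp (-(A t / ε)) := by
      intro s hs
      have hd : ∀ t, HasDerivAt (fun t => K / a₀ * ε ^ 2 * rexp (-(A t / ε)) - s * w t)
          (K / a₀ * ε ^ 2 * (rexp (-(A t / ε)) * (-(astar t / ε)))
            - s * (ε * deriv g t * rexp (-(A t / ε)))) t := fun t =>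
        ((hEm t).const_mul _).sub ((hw t).const_mul s)
      have hm : Monotone (fun t => K / a₀ * ε ^ 2 * rexp (-(A t / ε)) - s * w t) := by
        refine monotone_of_deriv_nonneg (fun t => (hd t).differentiableAt) fun t => ?_
        rw [(hd t).deriv]
        have e : K / a₀ * ε ^ 2 * (rexp (-(A t / ε)) * (-(astar t / ε)))
            - s * (ε * deriv g t * rexp (-(A t / ε)))
            = ε * rexp (-(A t / ε)) * (K / a₀ * (-astar t) - s * deriv g t) := by
          field_simp
        rw [e]
        have h1 : s * deriv g t ≤ K := by
          refine (le_abs_self _).trans ?_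
          rw [abs_mul, hs, one_mul]; exact hgb t
        have h2 : K ≤ K / a₀ * (-astar t) := by
          calc K = K / a₀ * a₀ := by field_simp
            _ ≤ _ := mul_le_mul_of_nonneg_left (by linarith [hastab t]) (by positivity)
        exact mul_nonneg (by positivity) (by linarith)
      have h := hm ht
      simp only [hw0, hA0] at h
      have : 0 ≤ K / a₀ * ε ^ 2 := by positivity
      simp at h
      linarith
    have hwb : |w t| ≤ K / a₀ * ε ^ 2 * rexp (-(A t / ε)) := by
      rw [abs_le]
      have h1 := key 1 (by simp)
      have h2 := key (-1) (by simp)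
      constructor <;> linarith
    have e : xstar t + ε * g t - rexp (A t / ε) * w t - xstar t - ε * deriv xstar t / astar t
        = -(rexp (A t / ε) * w t) := by
      rw [hg]; ring
    show |xstar t + ε * g t - rexp (A t / ε) * w t - xstar t - ε * deriv xstar t / astar t| ≤ _
    rw [e, abs_neg, abs_mul, abs_of_pos (Real.exp_pos _)]
    calc rexp (A t / ε) * |w t| ≤ rexp (A t / ε) * (K / a₀ * ε ^ 2 * rexp (-(A t / ε))) :=
          mul_le_mul_of_nonneg_left hwb (Real.exp_pos _).le
      _ = K / a₀ * ε ^ 2 := by linear_combination (K / a₀ * ε ^ 2) * hEE t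
  · intro x hx t _
    obtain ⟨y, hydef⟩ : ∃ y : ℝ → ℝ,
      y = (fun t => xstar t + ε * g t - rexp (A t / ε) * w t) := ⟨_, rfl⟩
    have hy : ∀ t, HasDerivAt y (astar t * (y t - xstar t) / ε) t := by
      rw [hydef]; exact hsol
    rw [← hydef]
    have hd : ∀ t, HasDerivAt (fun t => (x t - y t) * rexp (-(A t / ε))) 0 t := fun t => by
      refine (((hx t).sub (hy t)).mul (hEm t)).congr_deriv ?_
      simp only [Pi.sub_apply]
      field_simp
      ring
    have hc := is_const_of_deriv_eq_zero (fun t => (hd t).differentiableAt)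
      (fun t => (hd t).deriv) t 0
    simp only [hA0] at hc
    simp at hc
    rw [← hc]
    linear_combination (-(x t - y t)) * hEE t
end

section
/- Let t₀ < T, let μ : [t₀, T] → ℝ be continuous, let ε > 0 and let x be the solution of the deterministic equation ε ẋ = μ(t) x − x³ with initial condition x_{t₀} = x₀ > 0. Set α(t,t₀) = ∫_{t₀}^t μ(s) ds. Then for every t ∈ [t₀, T]: 0 < x_t ≤ x₀ · e^{α(t,t₀)/ε}. In particular, if μ is negative on (t₀, 0) and positive afterwards, then x_t remains exponentially small (bounded by x₀ e^{α(t,t₀)/ε} with α(t,t₀) < 0) for all t < Π(t₀), where Π(t₀) is the first time t > 0 with α(t,t₀) = 0; this is the deterministic bifurcation delay. -/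
open MeasureTheory Real Set

/-- deterministic bifurcation delay bound. For the dynamic pitchfork
equation `εẋ = μ(t)x - x³` with `x_{t₀} = x₀ > 0`, the solution satisfies
`0 < x_t ≤ x₀ e^{α(t,t₀)/ε}` with `α(t,t₀) = ∫_{t₀}^t μ(s) ds`; in particular it remains
exponentially small as long as `α(t,t₀) < 0`, i.e. up to the deterministic bifurcation
delay time `Π(t₀)`. -/
theorem statement_19
    (μ : ℝ → ℝ) (t₀ T x₀ ε : ℝ) (ht : t₀ < T) (hx₀ : 0 < x₀) (hε : 0 < ε)
    (hμ : ContinuousOn μ (Icc t₀ T))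
    (x : ℝ → ℝ) (hinit : x t₀ = x₀)
    (hode : ∀ t ∈ Icc t₀ T, HasDerivAt x ((μ t * x t - x t ^ 3) / ε) t) :
    ∀ t ∈ Icc t₀ T,
      0 < x t ∧ x t ≤ x₀ * Real.exp ((∫ s in t₀..t, μ s) / ε) := by
  have hxc : ContinuousOn x (Icc t₀ T) := fun t h => (hode t h).continuousAt.continuousWithinAt
  have hgc : ContinuousOn (fun t => (μ t - x t ^ 2) / ε) (Icc t₀ T) :=
    (hμ.sub (hxc.pow 2)).div_const ε
  -- a globally continuous extension of the growth rate
  obtain ⟨g, hg, hgeq⟩ : ∃ g : ℝ → ℝ, Continuous g ∧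
      ∀ t ∈ Icc t₀ T, g t = (μ t - x t ^ 2) / ε := by
    refine ⟨IccExtend ht.le (restrict (Icc t₀ T) (fun t => (μ t - x t ^ 2) / ε)),
      (continuousOn_iff_continuous_restrict.1 hgc).Icc_extend', ?_⟩
    intro t h
    rw [IccExtend_of_mem _ _ h]
    rfl
  have hG : ∀ t, HasDerivAt (fun t => ∫ s in t₀..t, g s) (g t) t := fun t =>
    hg.integral_hasStrictDerivAt t₀ t |>.hasDerivAt
  have hy : ∀ t ∈ Icc t₀ T,
      HasDerivAt (fun t => x t * Real.exp (-∫ s in t₀..t, g s)) 0 t := by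
    intro t h
    have h1 := (hode t h).mul (hG t).neg.exp
    refine h1.congr_deriv ?_
    rw [hgeq t h]
    simp only [Pi.neg_apply]
    field_simp
    ring
  have hconst : ∀ t ∈ Icc t₀ T, x t * Real.exp (-∫ s in t₀..t, g s) = x₀ := by
    intro t h
    have := constant_of_has_deriv_right_zero
      (fun t h => (hy t h).continuousAt.continuousWithinAt)
      (fun t h => (hy t (Ico_subset_Icc_self h)).hasDerivWithinAt) t h
    simpa [hinit] using this
  intro t h
  have hx : x t = x₀ * Real.exp (∫ s in t₀..t, g s) := by
    rw [← hconst t h, mul_assoc, ← Real.exp_add]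
    simp
  rw [hx]
  refine ⟨by positivity, ?_⟩
  gcongr
  rw [← intervalIntegral.integral_div]
  have hsub : Icc t₀ t ⊆ Icc t₀ T := Icc_subset_Icc_right h.2
  refine intervalIntegral.integral_mono_on h.1 (hg.intervalIntegrable _ _)
    (((hμ.mono hsub).div_const ε).intervalIntegrable_of_Icc h.1) ?_
  intro s hs
  rw [hgeq s (hsub hs)]
  gcongr
  nlinarith [sq_nonneg (x s)]
end
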